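/- arXiv:cs/0512025 — 2 statements merged into one kernel-verified Lean document; each statement's English description precedes it below -/
import Mathlib

section
/- Let n ≥ 3, k ≥ 1, and t ∈ (−1, 1). Let S_k be the (k+1)×(k+1) symmetric tridiagonal matrix with zero diagonal and off-diagonal entries a_i = √((n+i−2)(i+1)/((n+2i)(n+2i−2))) for i = 0,…,k−1. If λmax(S_{k−1}) ≥ t and λmax(S_k) < 1, then every finite set C of unit vectors in ℝ^n satisfying ⟨x,y⟩ ≤ t for all distinct x, y ∈ C has |C| ≤ 4·C(n+k−2, k) / (1 − λmax(S_k)). -/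
/-- Symmetric tridiagonal (k+1)×(k+1) matrix with diagonal `d 0, …, d k` and
off-diagonal `o 0, …, o (k-1)`. -/
noncomputable def Tridiag (k : ℕ) (d o : ℕ → ℝ) : Matrix (Fin (k + 1)) (Fin (k + 1)) ℝ :=
  Matrix.of fun i j =>
    if (i : ℕ) = (j : ℕ) then d i
    else if (i : ℕ) + 1 = (j : ℕ) then o i
    else if (j : ℕ) + 1 = (i : ℕ) then o j
    else 0

/-- The largest eigenvalue of a real square matrix. -/
noncomputable def maxEig {m : ℕ} (M : Matrix (Fin m) (Fin m) ℝ) : ℝ :=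
  sSup {μ : ℝ | Module.End.HasEigenvalue (Matrix.toLin' M) μ}

section
open Matrix

lemma eigenvalues_eq_spectrum {m : ℕ} (M : Matrix (Fin m) (Fin m) ℝ) :
    {μ : ℝ | Module.End.HasEigenvalue (Matrix.toLin' M) μ} = spectrum ℝ M := by
  ext μ
  rw [Set.mem_ofPred_eq, Module.End.hasEigenvalue_iff_mem_spectrum, Matrix.spectrum_toLin']

lemma maxEig_mem {m : ℕ} {M : Matrix (Fin (m + 1)) (Fin (m + 1)) ℝ} (hM : M.IsHermitian) :
    maxEig M ∈ spectrum ℝ M := by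
  rw [maxEig, eigenvalues_eq_spectrum]
  exact (Matrix.finite_real_spectrum (A := M)).isCompact.sSup_mem
    ⟨_, hM.eigenvalues_mem_spectrum_real 0⟩

lemma posSemidef_maxEig_sub {m : ℕ} {M : Matrix (Fin m) (Fin m) ℝ} (hM : M.IsHermitian) :
    (algebraMap ℝ _ (maxEig M) - M).PosSemidef := by
  rw [Matrix.posSemidef_iff_isHermitian_and_spectrum_nonneg]
  refine ⟨?_, ?_⟩
  · exact IsSelfAdjoint.sub (IsSelfAdjoint.algebraMap _ (IsSelfAdjoint.all _)) hM
  · rw [← spectrum.singleton_sub_eq]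
    rintro _ ⟨_, rfl, s, hs, rfl⟩
    have := le_csSup (Matrix.finite_real_spectrum (A := M)).bddAbove hs
    rw [← eigenvalues_eq_spectrum] at this
    exact sub_nonneg.2 this

lemma dotProduct_mulVec_le_maxEig {m : ℕ} {M : Matrix (Fin m) (Fin m) ℝ} (hM : M.IsHermitian)
    (v : Fin m → ℝ) : v ⬝ᵥ M *ᵥ v ≤ maxEig M * (v ⬝ᵥ v) := by
  have := (posSemidef_maxEig_sub hM).dotProduct_mulVec_nonneg v
  rw [Algebra.algebraMap_eq_smul_one, sub_mulVec, smul_mulVec, one_mulVec, dotProduct_sub,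
    dotProduct_smul, star_trivial, smul_eq_mul] at this
  linarith

lemma mulVec_eq_of_maxEig_le {m : ℕ} {M : Matrix (Fin m) (Fin m) ℝ} (hM : M.IsHermitian)
    {v : Fin m → ℝ} (hv : maxEig M * (v ⬝ᵥ v) ≤ v ⬝ᵥ M *ᵥ v) : M *ᵥ v = maxEig M • v := by
  have h := ((posSemidef_maxEig_sub hM).dotProduct_mulVec_zero_iff v).1 (by
    rw [Algebra.algebraMap_eq_smul_one, sub_mulVec, smul_mulVec, one_mulVec, dotProduct_sub,
      dotProduct_smul, star_trivial, smul_eq_mul]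
    linarith [dotProduct_mulVec_le_maxEig hM v])
  rw [Algebra.algebraMap_eq_smul_one, sub_mulVec, smul_mulVec, one_mulVec] at h
  exact (sub_eq_zero.1 h).symm

lemma exists_maxEig_eigenvector {m : ℕ} {M : Matrix (Fin (m + 1)) (Fin (m + 1)) ℝ}
    (hM : M.IsHermitian) : ∃ v : Fin (m + 1) → ℝ, v ≠ 0 ∧ M *ᵥ v = maxEig M • v := by
  have h := maxEig_mem hM
  rw [← eigenvalues_eq_spectrum] at h
  obtain ⟨v, hv⟩ := Module.End.HasEigenvalue.exists_hasEigenvector h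
  exact ⟨v, hv.2, by simpa using hv.apply_eq_smul⟩

/-- Perron–Frobenius for symmetric matrices. -/
lemma exists_nonneg_maxEig_eigenvector {m : ℕ} {M : Matrix (Fin (m + 1)) (Fin (m + 1)) ℝ}
    (hM : M.IsHermitian) (hoff : ∀ i j, i ≠ j → 0 ≤ M i j) :
    ∃ v : Fin (m + 1) → ℝ, v ≠ 0 ∧ 0 ≤ v ∧ M *ᵥ v = maxEig M • v := by
  obtain ⟨v, hv0, hv⟩ := exists_maxEig_eigenvector hM
  refine ⟨|v|, fun h => hv0 (funext fun i => abs_eq_zero.1 (congrFun h i)), abs_nonneg v,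
    mulVec_eq_of_maxEig_le hM ?_⟩
  have h1 : |v| ⬝ᵥ |v| = v ⬝ᵥ v := by simp [dotProduct]
  have h2 : v ⬝ᵥ M *ᵥ v = maxEig M * (v ⬝ᵥ v) := by rw [hv, dotProduct_smul, smul_eq_mul]
  rw [h1, ← h2]
  simp only [dotProduct, mulVec, Finset.mul_sum]
  refine Finset.sum_le_sum fun i _ => Finset.sum_le_sum fun j _ => ?_
  by_cases hij : i = j
  · subst hij
    simp only [Pi.abs_apply]
    exact le_of_eq (by linear_combination -M i i * abs_mul_abs_self (v i))
  · have : v i * v j ≤ |v i| * |v j| := by rw [← abs_mul]; exact le_abs_self _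
    simp only [Pi.abs_apply]
    nlinarith [hoff i j hij]

lemma Tridiag_isHermitian (k : ℕ) (d o : ℕ → ℝ) : (Tridiag k d o).IsHermitian := by
  ext i j
  simp only [conjTranspose_apply, Tridiag, of_apply, star_trivial]
  split_ifs <;> first | rfl | omega | simp_all

lemma Tridiag_eq_add_diagonal (k : ℕ) (d o : ℕ → ℝ) :
    Tridiag k d o = Tridiag k (fun _ => 0) o + diagonal fun i : Fin (k + 1) => d i := by
  ext i j
  simp only [Tridiag, of_apply, Matrix.add_apply, diagonal_apply, Fin.ext_iff]
  split_ifs <;> simp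

lemma sum_Tridiag_mul (k : ℕ) (d o P : ℕ → ℝ) (j : Fin (k + 1)) :
    ∑ i, Tridiag k d o i j * P i = d j * P j + (if (j : ℕ) < k then o j * P (j + 1) else 0)
      + (if 0 < (j : ℕ) then o (j - 1) * P (j - 1) else 0) := by
  have key : ∀ i : Fin (k + 1), Tridiag k d o i j * P i =
      (if (i : ℕ) = j then d j * P j else 0) + (if (i : ℕ) = j + 1 then o j * P (j + 1) else 0)
      + (if (i : ℕ) = j - 1 then (if 0 < (j : ℕ) then o (j - 1) * P (j - 1) else 0) else 0) := by
    rintro ⟨i, hi⟩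
    obtain ⟨j, hj⟩ := j
    simp only [Tridiag, of_apply]
    rcases lt_trichotomy i j with h | h | h
    · by_cases h1 : i + 1 = j
      · subst h1; simp [show i ≠ i + 1 + 1 by omega]
      · rw [if_neg (by omega), if_neg h1, if_neg (by omega), if_neg (by omega), if_neg (by omega),
          if_neg (by omega)]
        simp
    · subst h
      rcases Nat.eq_zero_or_pos i with h0 | h0
      · simp [h0]
      · simp [show i ≠ i - 1 by omega]
    · by_cases h1 : j + 1 = i
      · subst h1; simp [show j + 1 ≠ j - 1 by omega, show j + 1 + 1 ≠ j by omega]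
      · rw [if_neg (by omega), if_neg (by omega), if_neg h1, if_neg (by omega), if_neg (by omega),
          if_neg (by omega)]
        simp
  simp only [key, Finset.sum_add_distrib]
  rw [Fin.sum_univ_eq_sum_range (fun i => if i = (j : ℕ) then d j * P j else 0),
    Fin.sum_univ_eq_sum_range (fun i => if i = (j : ℕ) + 1 then o j * P (j + 1) else 0),
    Fin.sum_univ_eq_sum_range (fun i => if i = (j : ℕ) - 1 then
      (if 0 < (j : ℕ) then o (j - 1) * P (j - 1) else 0) else 0),
    Finset.sum_ite_eq', Finset.sum_ite_eq', Finset.sum_ite_eq',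
    if_pos (c := (j : ℕ) ∈ _) (by rw [Finset.mem_range]; omega),
    if_pos (c := (j : ℕ) - 1 ∈ _) (by rw [Finset.mem_range]; omega)]
  simp

lemma sub_eigenvalue_mul_sum {k : ℕ} {ρ l x : ℝ} {o P : ℕ → ℝ} {f : Fin (k + 1) → ℝ}
    (hP : ∀ j, x * P j = o j * P (j + 1) + if 0 < j then o (j - 1) * P (j - 1) else 0)
    (hf : Tridiag k (fun i => if i = k then -ρ else 0) o *ᵥ f = l • f) :
    (x - l) * ∑ i, f i * P i = f (Fin.last k) * (o k * P (k + 1) + ρ * P k) := by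
  have h1 : l * ∑ i, f i * P i
      = ∑ j, f j * ∑ i, Tridiag k (fun i => if i = k then -ρ else 0) o i j * P i := by
    have : ∀ i, l * (f i * P i)
        = ∑ j, Tridiag k (fun i => if i = k then -ρ else 0) o i j * f j * P i := by
      intro i
      have := congrFun hf i
      simp only [mulVec, dotProduct, Pi.smul_apply, smul_eq_mul] at this
      rw [← mul_assoc, ← this, Finset.sum_mul]
    rw [Finset.mul_sum, Finset.sum_congr rfl fun i _ => this i, Finset.sum_comm]
    refine Finset.sum_congr rfl fun j _ => ?_
    rw [Finset.mul_sum]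
    exact Finset.sum_congr rfl fun i _ => by ring
  have h2 : ∀ j : Fin (k + 1), x * (f j * P j)
      - f j * ∑ i, Tridiag k (fun i => if i = k then -ρ else 0) o i j * P i
      = if j = Fin.last k then f (Fin.last k) * (o k * P (k + 1) + ρ * P k) else 0 := by
    intro j
    rw [sum_Tridiag_mul, mul_left_comm, hP]
    by_cases hj : j = Fin.last k
    · subst hj
      simp
      ring
    · have : (j : ℕ) < k := lt_of_le_of_ne (Nat.lt_succ_iff.1 j.2) fun h => hj (Fin.ext h)
      rw [if_neg this.ne, if_pos this, if_neg hj]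
      ring
  rw [sub_mul, h1, Finset.mul_sum, ← Finset.sum_sub_distrib, Finset.sum_congr rfl fun j _ => h2 j]
  simp

lemma maxEig_Tridiag_le_succ (m : ℕ) (d d' o : ℕ → ℝ) (h : ∀ i ≤ m, d i = d' i) :
    maxEig (Tridiag m d o) ≤ maxEig (Tridiag (m + 1) d' o) := by
  obtain ⟨v, hv0, hv⟩ := exists_maxEig_eigenvector (Tridiag_isHermitian m d o)
  have hpos : 0 < v ⬝ᵥ v := by simpa using dotProduct_star_self_pos_iff.2 hv0
  have h1 := dotProduct_mulVec_le_maxEig (Tridiag_isHermitian (m + 1) d' o) (Fin.snoc v 0)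
  have h2 : (Fin.snoc v 0 : Fin (m + 2) → ℝ) ⬝ᵥ (Fin.snoc v 0 : Fin (m + 2) → ℝ) = v ⬝ᵥ v := by
    simp [dotProduct, Fin.sum_univ_castSucc (n := m + 1)]
  have h3 : (Fin.snoc v 0 : Fin (m + 2) → ℝ) ⬝ᵥ
      Tridiag (m + 1) d' o *ᵥ (Fin.snoc v 0 : Fin (m + 2) → ℝ) = v ⬝ᵥ Tridiag m d o *ᵥ v := by
    simp only [dotProduct, mulVec, Fin.sum_univ_castSucc (n := m + 1), Fin.snoc_castSucc,
      Fin.snoc_last, mul_zero, zero_mul, add_zero]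
    refine Finset.sum_congr rfl fun i _ => ?_
    congr 1
    refine Finset.sum_congr rfl fun j _ => ?_
    simp [Tridiag, h i (Nat.lt_succ_iff.1 i.2)]
  rw [h2, h3, hv, dotProduct_smul, smul_eq_mul] at h1
  exact le_of_mul_le_mul_right h1 hpos

lemma maxEig_Tridiag_mono (m : ℕ) (d d' o : ℕ → ℝ) (h : ∀ i, d i ≤ d' i) :
    maxEig (Tridiag m d o) ≤ maxEig (Tridiag m d' o) := by
  obtain ⟨v, hv0, hv⟩ := exists_maxEig_eigenvector (Tridiag_isHermitian m d o)
  have hpos : 0 < v ⬝ᵥ v := by simpa using dotProduct_star_self_pos_iff.2 hv0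
  have h1 := dotProduct_mulVec_le_maxEig (Tridiag_isHermitian m d' o) v
  have h2 : v ⬝ᵥ Tridiag m d o *ᵥ v ≤ v ⬝ᵥ Tridiag m d' o *ᵥ v := by
    rw [Tridiag_eq_add_diagonal m d, Tridiag_eq_add_diagonal m d', add_mulVec, add_mulVec,
      dotProduct_add, dotProduct_add]
    refine add_le_add_right ?_ _
    simp only [dotProduct, mulVec_diagonal]
    exact Finset.sum_le_sum fun i _ => by nlinarith [h i, mul_self_nonneg (v i)]
  rw [hv, dotProduct_smul, smul_eq_mul] at h2
  exact le_of_mul_le_mul_right (h2.trans h1) hpos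
end

section
open Polynomial

/-- Gegenbauer polynomials of order `ν / 2`, normalized to take the value `1` at `1`. -/
noncomputable def gegenbauer (ν : ℝ) : ℕ → ℝ[X]
  | 0 => 1
  | 1 => X
  | i + 2 => C (((i : ℝ) + 1 + ν)⁻¹) *
      (C (2 * ((i : ℝ) + 1) + ν) * X * gegenbauer ν (i + 1) - C ((i : ℝ) + 1) * gegenbauer ν i)

section
variable {ν : ℝ}

/-- The recurrence, valid also for `i = 0` since the last term then vanishes. -/
lemma gegenbauer_rec (hν : 0 < ν) (i : ℕ) :
    C ((i : ℝ) + ν) * gegenbauer ν (i + 1)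
      = C (2 * (i : ℝ) + ν) * X * gegenbauer ν i - C (i : ℝ) * gegenbauer ν (i - 1) := by
  cases i with
  | zero => simp [gegenbauer]
  | succ i =>
    have h : (i : ℝ) + 1 + ν ≠ 0 := by positivity
    rw [gegenbauer]
    push_cast
    rw [← mul_assoc, ← C_mul, mul_inv_cancel₀ h]
    simp

lemma eval_gegenbauer_rec (hν : 0 < ν) (i : ℕ) (s : ℝ) :
    ((i : ℝ) + ν) * (gegenbauer ν (i + 1)).eval s
      = (2 * (i : ℝ) + ν) * s * (gegenbauer ν i).eval s - i * (gegenbauer ν (i - 1)).eval s := by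
  simpa using congrArg (eval s) (gegenbauer_rec hν i)

lemma eval_one_gegenbauer (hν : 0 < ν) (i : ℕ) : (gegenbauer ν i).eval 1 = 1 := by
  induction i using Nat.strong_induction_on with
  | _ i ih =>
    match i with
    | 0 => simp [gegenbauer]
    | 1 => simp [gegenbauer]
    | i + 2 =>
      have h := eval_gegenbauer_rec hν (i + 1) 1
      rw [ih (i + 1) (by omega), Nat.add_sub_cancel, ih i (by omega)] at h
      have h0 : ((i + 1 : ℕ) : ℝ) + ν ≠ 0 := by positivity
      exact mul_left_cancel₀ h0 (by rw [h]; ring)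

lemma one_sub_sq_mul_derivative_gegenbauer (hν : 0 < ν) (i : ℕ) (s : ℝ) :
    (1 - s ^ 2) * (derivative (gegenbauer ν i)).eval s
      = i * ((gegenbauer ν (i - 1)).eval s - s * (gegenbauer ν i).eval s) := by
  induction i using Nat.strong_induction_on with
  | _ i ih =>
    match i with
    | 0 => simp [gegenbauer]
    | 1 => simp [gegenbauer]; ring
    | i + 2 =>
      have hd := congrArg (fun p => eval s (derivative p)) (gegenbauer_rec hν (i + 1))
      have hr := eval_gegenbauer_rec hν (i + 1) s
      have hr' := eval_gegenbauer_rec hν i s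
      have h1 := ih (i + 1) (by omega)
      have h0 := ih i (by omega)
      simp only [derivative_mul, derivative_sub, derivative_C, derivative_X, eval_add, eval_sub,
        eval_mul, eval_C, eval_X, zero_mul, zero_add, mul_one, Nat.add_sub_cancel] at hd hr h1 h0
      push_cast at hd hr h1 h0 ⊢
      have h : (i : ℝ) + 1 + ν ≠ 0 := by positivity
      refine mul_left_cancel₀ h ?_
      simp only [show i + 1 + 1 = i + 2 by omega] at *
      linear_combination (1 - s ^ 2) * hd + (2 * ((i : ℝ) + 1) + ν) * s * h1 - ((i : ℝ) + 1) * h0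
        + ((i : ℝ) + 2) * s * hr - ((i : ℝ) + 1) * hr'
end

/-- The normalization constants `1 / ∫ G_i ^ 2` of the Gegenbauer polynomials. -/
noncomputable def gegenbauerWeight (ν : ℝ) : ℕ → ℝ
  | 0 => 1
  | i + 1 => gegenbauerWeight ν i * ((i + ν) * (2 * i + 2 + ν)) / ((i + 1) * (2 * i + ν))

lemma gegenbauerWeight_pos {ν : ℝ} (hν : 0 < ν) (i : ℕ) : 0 < gegenbauerWeight ν i := by
  induction i with
  | zero => simp [gegenbauerWeight]
  | succ i ih => rw [gegenbauerWeight]; positivity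

lemma gegenbauerWeight_mul (m : ℕ) (hm : 0 < m) (k : ℕ) :
    gegenbauerWeight m k * ((k + m) / (2 * k + m)) = Nat.choose (m + k) k := by
  have hm' : (0 : ℝ) < m := by exact_mod_cast hm
  induction k with
  | zero => simp [gegenbauerWeight, hm'.ne']
  | succ k ih =>
    have h : ((m + k + 1).choose (k + 1) : ℝ) * (k + 1) = (m + k + 1) * (m + k).choose k := by
      exact_mod_cast (Nat.add_one_mul_choose_eq (m + k) k).symm
    have h1 : (0 : ℝ) < k + 1 := by positivity
    rw [← ih] at h
    rw [← add_assoc, ← mul_right_cancel_iff_of_pos h1, h, gegenbauerWeight]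
    push_cast
    field_simp
    ring

/-- The moments of a coordinate on the sphere of dimension `ν + 1`. -/
noncomputable def sphereMoment (ν : ℝ) : ℕ → ℝ
  | 0 => 1
  | 1 => 0
  | b + 2 => (b + 1) / (ν + 2 + b) * sphereMoment ν b

/-- The Funk–Hecke eigenvalues of monomials. -/
noncomputable def funkHeckeCoeff (ν : ℝ) : ℕ → ℕ → ℝ
  | 0, b => sphereMoment ν b
  | i + 1, b => b * funkHeckeCoeff ν i (b - 1) / (ν + 1 + b + i)

lemma funkHeckeCoeff_consistent {ν : ℝ} (hν : 0 < ν) (i b : ℕ) :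
    ((b : ℝ) - i) * funkHeckeCoeff ν i b = b * funkHeckeCoeff ν (i + 1) (b - 1) := by
  induction i generalizing b with
  | zero =>
    match b with
    | 0 => simp
    | 1 => simp [funkHeckeCoeff, sphereMoment]
    | b + 2 =>
      simp only [funkHeckeCoeff, sphereMoment, show b + 2 - 1 = b + 1 by omega, Nat.add_sub_cancel]
      push_cast
      have : ν + 2 + b ≠ 0 := by positivity
      have : ν + 1 + (b + 1) + 0 ≠ 0 := by positivity
      field_simp
      ring
  | succ i ih =>
    cases b with
    | zero => simp [funkHeckeCoeff]
    | succ b =>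
      have h := ih b
      rw [funkHeckeCoeff, funkHeckeCoeff]
      simp only [Nat.add_sub_cancel]
      push_cast
      have h1 : ν + 1 + (b + 1) + i ≠ 0 := by positivity
      have h2 : ν + 1 + b + (i + 1) ≠ 0 := by positivity
      field_simp
      linear_combination (ν + 1 + b + (i + 1)) * h

lemma funkHeckeCoeff_eq_zero (ν : ℝ) {i b : ℕ} (h : b < i) : funkHeckeCoeff ν i b = 0 := by
  induction i generalizing b with
  | zero => omega
  | succ i ih =>
    rw [funkHeckeCoeff]
    cases b with
    | zero => simp
    | succ b => rw [Nat.add_sub_cancel, ih (by omega)]; simp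

lemma natDegree_gegenbauer_le (ν : ℝ) (i : ℕ) : (gegenbauer ν i).natDegree ≤ i := by
  induction i using Nat.strong_induction_on with
  | _ i ih =>
    match i with
    | 0 => simp [gegenbauer]
    | 1 => simp [gegenbauer]
    | i + 2 =>
      rw [gegenbauer]
      refine (natDegree_C_mul_le _ _).trans ((natDegree_sub_le _ _).trans (max_le ?_ ?_))
      · rw [mul_assoc, X_mul]
        refine (natDegree_C_mul_le _ _).trans (natDegree_mul_le.trans ?_)
        rw [natDegree_X]
        have := ih (i + 1) (by omega)
        omega
      · have := ih i (by omega)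
        exact (natDegree_C_mul_le _ _).trans (by omega)
end

section
open RealInnerProductSpace MeasureTheory

section
variable {E : Type*} [NormedAddCommGroup E] [InnerProductSpace ℝ E]

/-- Rotation by the angle `θ` in the plane of two orthonormal vectors. -/
noncomputable def planeRotation (u v : E) (θ : ℝ) : E →L[ℝ] E :=
  ContinuousLinearMap.id ℝ E
    + (Real.cos θ - 1) • ((innerSL ℝ u).smulRight u + (innerSL ℝ v).smulRight v)
    + Real.sin θ • ((innerSL ℝ u).smulRight v - (innerSL ℝ v).smulRight u)

lemma planeRotation_apply (u v : E) (θ : ℝ) (z : E) :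
    planeRotation u v θ z = z + (Real.cos θ - 1) • (⟪u, z⟫ • u + ⟪v, z⟫ • v)
      + Real.sin θ • (⟪u, z⟫ • v - ⟪v, z⟫ • u) := by
  simp [planeRotation]

lemma norm_planeRotation {u v : E} (hu : ‖u‖ = 1) (hv : ‖v‖ = 1) (huv : ⟪u, v⟫ = 0) (θ : ℝ)
    (z : E) : ‖planeRotation u v θ z‖ = ‖z‖ := by
  have huu : ⟪u, u⟫ = 1 := by rw [real_inner_self_eq_norm_sq, hu]; norm_num
  have hvv : ⟪v, v⟫ = 1 := by rw [real_inner_self_eq_norm_sq, hv]; norm_num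
  have hvu : ⟪v, u⟫ = 0 := by rw [real_inner_comm]; exact huv
  rw [← sq_eq_sq₀ (norm_nonneg _) (norm_nonneg _), ← real_inner_self_eq_norm_sq,
    ← real_inner_self_eq_norm_sq, planeRotation_apply]
  simp only [inner_add_left, inner_add_right, inner_sub_left, inner_sub_right,
    real_inner_smul_left, real_inner_smul_right, huu, hvv, huv, hvu]
  rw [real_inner_comm u z, real_inner_comm v z]
  linear_combination (⟪u, z⟫ ^ 2 + ⟪v, z⟫ ^ 2) * Real.sin_sq_add_cos_sq θ

lemma hasDerivAt_planeRotation (u v z : E) (θ : ℝ) :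
    HasDerivAt (fun θ => planeRotation u v θ z)
      ((-Real.sin θ) • (⟪u, z⟫ • u + ⟪v, z⟫ • v) + Real.cos θ • (⟪u, z⟫ • v - ⟪v, z⟫ • u)) θ := by
  simp only [planeRotation_apply]
  exact ((((Real.hasDerivAt_cos θ).sub_const 1).smul_const _).const_add z).add
    ((Real.hasDerivAt_sin θ).smul_const _)

variable [FiniteDimensional ℝ E] [MeasurableSpace E] [BorelSpace E]

variable (E) in
/-- A rotation invariant probability measure on the unit sphere exists. -/
lemma exists_invariant_sphere_measure [Nontrivial E] : ∃ σ : Measure E, IsProbabilityMeasure σ ∧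
    (∀ᵐ z ∂σ, ‖z‖ = 1) ∧ ∀ U : E ≃ₗᵢ[ℝ] E, MeasurePreserving U σ σ := by
  let μ : Measure E := ProbabilityTheory.cond volume (Metric.ball 0 1)
  have hμ : IsProbabilityMeasure μ := by
    apply ProbabilityTheory.cond_isProbabilityMeasure_of_finite
    · exact (Metric.measure_ball_pos _ _ one_pos).ne'
    · exact measure_ball_lt_top.ne
  have hdir : Measurable fun z : E => ‖z‖⁻¹ • z := by fun_prop
  refine ⟨μ.map fun z => ‖z‖⁻¹ • z, Measure.isProbabilityMeasure_map hdir.aemeasurable, ?_, ?_⟩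
  · rw [ae_map_iff hdir.aemeasurable (measurableSet_eq_fun measurable_norm measurable_const)]
    have h0 : ∀ᵐ z ∂(volume : Measure E), z ≠ 0 := by simp [ae_iff]
    have : ∀ᵐ z ∂μ, z ≠ 0 := ProbabilityTheory.cond_absolutelyContinuous.ae_le h0
    filter_upwards [this] with z hz
    rw [norm_smul, norm_inv, norm_norm, inv_mul_cancel₀ (norm_ne_zero_iff.2 hz)]
  · intro U
    refine ⟨U.continuous.measurable, ?_⟩
    have hU : μ.map U = μ := by
      have h := (U.measurePreserving.restrict_preimage
        (s := Metric.ball (0 : E) 1) measurableSet_ball).map_eq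
      have h' : U ⁻¹' Metric.ball 0 1 = Metric.ball 0 1 := by
        ext z; simp
      rw [h'] at h
      simp only [μ, ProbabilityTheory.cond, Measure.map_smul, h]
    rw [Measure.map_map U.continuous.measurable hdir]
    conv_rhs => rw [← hU, Measure.map_map hdir U.continuous.measurable]
    congr 1
    ext z
    simp

lemma integrable_of_continuous_of_sphere {σ : Measure E} [IsFiniteMeasure σ]
    (hσ : ∀ᵐ z ∂σ, ‖z‖ = 1) {g : E → ℝ} (hg : Continuous g) : Integrable g σ := by
  obtain ⟨B, hB⟩ := (isCompact_sphere (0 : E) 1).exists_bound_of_continuousOn hg.continuousOn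
  exact Integrable.of_bound hg.aestronglyMeasurable B
    (hσ.mono fun z hz => hB z (by simpa using hz))

/-- The infinitesimal generator of a rotation integrates to zero. -/
lemma integral_fderiv_rotation_eq_zero {σ : Measure E} [IsFiniteMeasure σ]
    (hσ : ∀ᵐ z ∂σ, ‖z‖ = 1) (hinv : ∀ U : E ≃ₗᵢ[ℝ] E, MeasurePreserving U σ σ)
    {u v : E} (hu : ‖u‖ = 1) (hv : ‖v‖ = 1) (huv : ⟪u, v⟫ = 0) {g : E → ℝ}
    (hg : ContDiff ℝ 1 g) : ∫ z, fderiv ℝ g z (⟪u, z⟫ • v - ⟪v, z⟫ • u) ∂σ = 0 := by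
  let D : ℝ → E → E := fun θ z =>
    (-Real.sin θ) • (⟪u, z⟫ • u + ⟪v, z⟫ • v) + Real.cos θ • (⟪u, z⟫ • v - ⟪v, z⟫ • u)
  let F' : ℝ → E → ℝ := fun θ z => fderiv ℝ g (planeRotation u v θ z) (D θ z)
  have hR : Continuous fun p : ℝ × E => planeRotation u v p.1 p.2 := by
    simp only [planeRotation_apply]
    fun_prop
  have hD : Continuous fun p : ℝ × E => D p.1 p.2 := by fun_prop
  have hF' : Continuous fun p : ℝ × E => F' p.1 p.2 :=
    ((hg.continuous_fderiv one_ne_zero).comp hR).clm_apply hD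
  have hconst : ∀ θ, ∫ z, g (planeRotation u v θ z) ∂σ = ∫ z, g z ∂σ := by
    intro θ
    let L : E →ₗᵢ[ℝ] E := ⟨planeRotation u v θ, norm_planeRotation hu hv huv θ⟩
    let U : E ≃ₗᵢ[ℝ] E := L.toLinearIsometryEquiv rfl
    exact (hinv U).integral_comp U.toHomeomorph.measurableEmbedding g
  obtain ⟨B, hB⟩ := ((isCompact_Icc (a := (-1 : ℝ)) (b := 1)).prod
    (isCompact_sphere (0 : E) 1)).exists_bound_of_continuousOn hF'.continuousOn
  have h := hasDerivAt_integral_of_dominated_loc_of_deriv_le (μ := σ)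
    (F := fun θ z => g (planeRotation u v θ z)) (F' := F') (x₀ := 0) (s := Set.Icc (-1) 1)
    (bound := fun _ => B) (Icc_mem_nhds (by norm_num) (by norm_num))
    (Filter.Eventually.of_forall fun θ =>
      (hg.continuous.comp (planeRotation u v θ).continuous).aestronglyMeasurable)
    (integrable_of_continuous_of_sphere hσ (hg.continuous.comp (planeRotation u v 0).continuous))
    (hF'.comp (by fun_prop : Continuous fun z : E => ((0 : ℝ), z))).aestronglyMeasurable
    (hσ.mono fun z hz θ hθ => hB (θ, z) ⟨hθ, by simpa using hz⟩)
    (integrable_const B)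
    (Filter.Eventually.of_forall fun z θ _ =>
      ((hg.differentiable one_ne_zero _).hasFDerivAt.comp_hasDerivAt θ
        (hasDerivAt_planeRotation u v z θ)))
  have h2 := h.2
  simp only [hconst] at h2
  have := h2.unique (hasDerivAt_const _ _)
  simpa [F', D, planeRotation_apply] using this
end

section
open Polynomial
variable {E : Type*} [NormedAddCommGroup E] [InnerProductSpace ℝ E] [FiniteDimensional ℝ E]
  [MeasurableSpace E] [BorelSpace E] {σ : Measure E}

/-- The divergence theorem on the sphere for the tangential part of the constant field `x`. -/
lemma integral_sphere_divergence [IsFiniteMeasure σ]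
    (hσ : ∀ᵐ z ∂σ, ‖z‖ = 1) (hinv : ∀ U : E ≃ₗᵢ[ℝ] E, MeasurePreserving U σ σ)
    {x y : E} (hx : ‖x‖ = 1) (q h : ℝ[X]) :
    ((Module.finrank ℝ E : ℝ) - 1) * ∫ z, ⟪x, z⟫ * (q.eval ⟪x, z⟫ * h.eval ⟪y, z⟫) ∂σ
      = ∫ z, ((1 - ⟪x, z⟫ ^ 2) * (derivative q).eval ⟪x, z⟫ * h.eval ⟪y, z⟫
        + (⟪x, y⟫ - ⟪x, z⟫ * ⟪y, z⟫) * q.eval ⟪x, z⟫ * (derivative h).eval ⟪y, z⟫) ∂σ := by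
  set b := stdOrthonormalBasis ℝ E
  have hb : ∀ i j, ⟪b i, b j⟫ = if i = j then 1 else 0 := orthonormal_iff_ite.1 b.orthonormal
  have hsum : ∀ u w : E, ∑ i, ⟪b i, u⟫ * ⟪b i, w⟫ = ⟪u, w⟫ := by
    intro u w
    rw [← b.sum_inner_mul_inner u w]
    exact Finset.sum_congr rfl fun i _ => by rw [real_inner_comm u]
  let A : E → ℝ := fun z => q.eval ⟪x, z⟫ * h.eval ⟪y, z⟫
  let B : E → ℝ := fun z => (derivative q).eval ⟪x, z⟫ * h.eval ⟪y, z⟫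
  let D : E → ℝ := fun z => q.eval ⟪x, z⟫ * (derivative h).eval ⟪y, z⟫
  have hA : Continuous A := by fun_prop
  have hB : Continuous B := by fun_prop
  have hD : Continuous D := by fun_prop
  let I : Fin (Module.finrank ℝ E) → Fin (Module.finrank ℝ E) → E → ℝ := fun i j z =>
    ⟪b i, z⟫ * A z + ⟪b j, z⟫ * (B z * (⟪b i, z⟫ * ⟪b j, x⟫ - ⟪b j, z⟫ * ⟪b i, x⟫)
      + D z * (⟪b i, z⟫ * ⟪b j, y⟫ - ⟪b j, z⟫ * ⟪b i, y⟫))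
  have hI : ∀ i j, Continuous (I i j) := fun i j => by fun_prop
  have hzero : ∀ i j, i ≠ j → ∫ z, I i j z ∂σ = 0 := by
    intro i j hij
    have hd : ∀ z, HasFDerivAt (fun z => ⟪b j, z⟫ * (q.eval ⟪x, z⟫ * h.eval ⟪y, z⟫))
        (⟪b j, z⟫ • (q.eval ⟪x, z⟫ • ((derivative h).eval ⟪y, z⟫ • innerSL ℝ y)
          + h.eval ⟪y, z⟫ • ((derivative q).eval ⟪x, z⟫ • innerSL ℝ x))
          + (q.eval ⟪x, z⟫ * h.eval ⟪y, z⟫) • innerSL ℝ (b j)) z := by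
      intro z
      exact ((innerSL ℝ (b j)).hasFDerivAt (x := z)).mul
        (((q.hasDerivAt _).comp_hasFDerivAt z ((innerSL ℝ x).hasFDerivAt (x := z))).mul
          ((h.hasDerivAt _).comp_hasFDerivAt z ((innerSL ℝ y).hasFDerivAt (x := z))))
    have hcd : ∀ p : ℝ[X], ContDiff ℝ 1 (fun s : ℝ => p.eval s) := fun p => by
      simpa using p.contDiff_aeval (𝕜 := ℝ) 1
    have hC : ContDiff ℝ 1 (fun z => ⟪b j, z⟫ * (q.eval ⟪x, z⟫ * h.eval ⟪y, z⟫)) :=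
      (innerSL ℝ (b j)).contDiff.mul (((hcd q).comp (innerSL ℝ x).contDiff).mul
        ((hcd h).comp (innerSL ℝ y).contDiff))
    have := integral_fderiv_rotation_eq_zero hσ hinv (b.norm_eq_one i) (b.norm_eq_one j)
      (by rw [hb, if_neg hij]) hC
    rw [← this]
    refine integral_congr_ae (Filter.Eventually.of_forall fun z => ?_)
    simp only [(hd z).fderiv, I, A, B, D]
    simp only [add_apply, smul_apply, innerSL_apply_apply,
      inner_sub_right, real_inner_smul_right, hb, smul_eq_mul, if_neg hij.symm, if_true]
    rw [real_inner_comm (b j) x, real_inner_comm (b i) x, real_inner_comm (b j) y,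
      real_inner_comm (b i) y]
    ring
  have hdiag : ∀ i, ∫ z, I i i z ∂σ = ∫ z, ⟪b i, z⟫ * A z ∂σ := fun i =>
    integral_congr_ae (Filter.Eventually.of_forall fun z => by simp only [I]; ring)
  have h1 : ∫ z, ∑ i, ∑ j, ⟪b i, x⟫ * I i j z ∂σ = ∫ z, ⟪x, z⟫ * A z ∂σ := by
    have hi : ∀ i j, Integrable (fun z => ⟪b i, x⟫ * I i j z) σ := fun i j =>
      integrable_of_continuous_of_sphere hσ (by fun_prop)
    have hs : ∀ i, ∑ j, ∫ z, ⟪b i, x⟫ * I i j z ∂σ = ∫ z, ⟪b i, x⟫ * (⟪b i, z⟫ * A z) ∂σ := by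
      intro i
      rw [Finset.sum_eq_single i]
      · rw [integral_const_mul, hdiag, integral_const_mul]
      · intro j _ hj
        rw [integral_const_mul, hzero i j hj.symm, mul_zero]
      · simp
    rw [integral_finsetSum _ fun i _ => integrable_finsetSum _ fun j _ => hi i j]
    simp_rw [integral_finsetSum _ fun j _ => hi _ j, hs]
    rw [← integral_finsetSum _ fun i _ => integrable_of_continuous_of_sphere hσ (by fun_prop)]
    refine integral_congr_ae (Filter.Eventually.of_forall fun z => ?_)
    simp only
    rw [← hsum x z, Finset.sum_mul]
    exact Finset.sum_congr rfl fun i _ => by ring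
  have h2 : ∀ z, ∑ i, ∑ j, ⟪b i, x⟫ * I i j z = Module.finrank ℝ E * (⟪x, z⟫ * A z)
      + B z * (⟪x, z⟫ ^ 2 - ⟪z, z⟫ * ⟪x, x⟫) + D z * (⟪x, z⟫ * ⟪y, z⟫ - ⟪z, z⟫ * ⟪x, y⟫) := by
    intro z
    have hin : ∀ i, ∑ j, ⟪b i, x⟫ * I i j z = (Module.finrank ℝ E * A z + B z * ⟪x, z⟫
        + D z * ⟪y, z⟫) * (⟪b i, x⟫ * ⟪b i, z⟫) - ⟪z, z⟫ * B z * (⟪b i, x⟫ * ⟪b i, x⟫)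
        - ⟪z, z⟫ * D z * (⟪b i, x⟫ * ⟪b i, y⟫) := by
      intro i
      have : ∀ j, ⟪b i, x⟫ * I i j z = ⟪b i, x⟫ * ⟪b i, z⟫ * A z
          + ⟪b i, x⟫ * ⟪b i, z⟫ * B z * (⟪b j, x⟫ * ⟪b j, z⟫)
          + ⟪b i, x⟫ * ⟪b i, z⟫ * D z * (⟪b j, y⟫ * ⟪b j, z⟫)
          - ⟪b i, x⟫ * (B z * ⟪b i, x⟫ + D z * ⟪b i, y⟫) * (⟪b j, z⟫ * ⟪b j, z⟫) := by
        intro j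
        simp only [I]
        ring
      simp only [this, Finset.sum_sub_distrib, Finset.sum_add_distrib, ← Finset.mul_sum, hsum]
      simp
      ring
    simp only [hin, Finset.sum_sub_distrib, ← Finset.mul_sum, hsum]
    ring
  simp only [h2] at h1
  have h3 : ∫ z, (Module.finrank ℝ E * (⟪x, z⟫ * A z)
      + B z * (⟪x, z⟫ ^ 2 - ⟪z, z⟫ * ⟪x, x⟫) + D z * (⟪x, z⟫ * ⟪y, z⟫ - ⟪z, z⟫ * ⟪x, y⟫)) ∂σ
      = ∫ z, (Module.finrank ℝ E * (⟪x, z⟫ * A z)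
        - ((1 - ⟪x, z⟫ ^ 2) * (derivative q).eval ⟪x, z⟫ * h.eval ⟪y, z⟫
        + (⟪x, y⟫ - ⟪x, z⟫ * ⟪y, z⟫) * q.eval ⟪x, z⟫ * (derivative h).eval ⟪y, z⟫)) ∂σ := by
    refine integral_congr_ae (hσ.mono fun z hz => ?_)
    simp only [real_inner_self_eq_norm_sq, hz, hx, B, D]
    ring
  rw [h3, integral_sub (integrable_of_continuous_of_sphere hσ (by fun_prop))
    (integrable_of_continuous_of_sphere hσ (by fun_prop)), integral_const_mul] at h1
  simp only [A] at h1
  linear_combination h1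

lemma integral_pow_sphere [IsProbabilityMeasure σ] {ν : ℝ} (hν : 0 < ν)
    (hn : (Module.finrank ℝ E : ℝ) = ν + 2)
    (hσ : ∀ᵐ z ∂σ, ‖z‖ = 1) (hinv : ∀ U : E ≃ₗᵢ[ℝ] E, MeasurePreserving U σ σ)
    {y : E} (hy : ‖y‖ = 1) (b : ℕ) : ∫ z, ⟪y, z⟫ ^ b ∂σ = sphereMoment ν b := by
  have hInt : ∀ b : ℕ, Integrable (fun z => ⟪y, z⟫ ^ b) σ := fun b =>
    integrable_of_continuous_of_sphere hσ (by fun_prop)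
  have key : ∀ b : ℕ, (ν + 1 + b) * ∫ z, ⟪y, z⟫ ^ (b + 1) ∂σ = b * ∫ z, ⟪y, z⟫ ^ (b - 1) ∂σ := by
    intro b
    have h := integral_sphere_divergence hσ hinv (y := y) hy (X ^ b) 1
    have e : ∀ z, (1 - ⟪y, z⟫ ^ 2) * (derivative (X ^ b : ℝ[X])).eval ⟪y, z⟫
        * (1 : ℝ[X]).eval ⟪y, z⟫ + (⟪y, y⟫ - ⟪y, z⟫ * ⟪y, z⟫) * (X ^ b : ℝ[X]).eval ⟪y, z⟫
        * (derivative (1 : ℝ[X])).eval ⟪y, z⟫ = b * ⟪y, z⟫ ^ (b - 1) - b * ⟪y, z⟫ ^ (b + 1) := by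
      intro z
      cases b with
      | zero => simp
      | succ b => simp; ring
    simp only [e] at h
    rw [integral_sub ((hInt _).const_mul _) ((hInt _).const_mul _), integral_const_mul,
      integral_const_mul, hn] at h
    simp only [eval_pow, eval_X, eval_one, mul_one, ← pow_succ'] at h
    linear_combination h
  induction b using Nat.strong_induction_on with
  | _ b ih =>
    match b with
    | 0 => simp [sphereMoment]
    | 1 =>
      have := key 0
      simpa [sphereMoment, show ν + 1 ≠ 0 by positivity] using this
    | b + 2 =>
      have h := key (b + 1)
      rw [Nat.add_sub_cancel, ih b (by omega)] at h
      push_cast at h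
      rw [sphereMoment]
      have : ν + 2 + b ≠ 0 := by positivity
      field_simp
      linear_combination h

lemma integral_gegenbauer_mul_pow [IsProbabilityMeasure σ] {ν : ℝ} (hν : 0 < ν)
    (hn : (Module.finrank ℝ E : ℝ) = ν + 2)
    (hσ : ∀ᵐ z ∂σ, ‖z‖ = 1) (hinv : ∀ U : E ≃ₗᵢ[ℝ] E, MeasurePreserving U σ σ)
    {x y : E} (hx : ‖x‖ = 1) (hy : ‖y‖ = 1) (i b : ℕ) :
    ∫ z, (gegenbauer ν i).eval ⟪x, z⟫ * ⟪y, z⟫ ^ b ∂σ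
      = funkHeckeCoeff ν i b * (gegenbauer ν i).eval ⟪x, y⟫ := by
  have hInt : ∀ (p : ℝ[X]) (b : ℕ), Integrable (fun z => p.eval ⟪x, z⟫ * ⟪y, z⟫ ^ b) σ :=
    fun p b => integrable_of_continuous_of_sphere hσ (by fun_prop)
  have key : ∀ i b : ℕ, (ν + 1 + b + i) * (i + ν) *
      ∫ z, (gegenbauer ν (i + 1)).eval ⟪x, z⟫ * ⟪y, z⟫ ^ b ∂σ
      = i * (i - 1 - b) * ∫ z, (gegenbauer ν (i - 1)).eval ⟪x, z⟫ * ⟪y, z⟫ ^ b ∂σ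
        + b * (2 * i + ν) * ⟪x, y⟫ * ∫ z, (gegenbauer ν i).eval ⟪x, z⟫ * ⟪y, z⟫ ^ (b - 1) ∂σ := by
    intro i b
    have h := integral_sphere_divergence hσ hinv (y := y) hx (gegenbauer ν i) (X ^ b)
    have e : ∀ z, (1 - ⟪x, z⟫ ^ 2) * (derivative (gegenbauer ν i)).eval ⟪x, z⟫
        * (X ^ b : ℝ[X]).eval ⟪y, z⟫ + (⟪x, y⟫ - ⟪x, z⟫ * ⟪y, z⟫) * (gegenbauer ν i).eval ⟪x, z⟫
        * (derivative (X ^ b : ℝ[X])).eval ⟪y, z⟫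
        = i * ((gegenbauer ν (i - 1)).eval ⟪x, z⟫ * ⟪y, z⟫ ^ b)
          + b * ⟪x, y⟫ * ((gegenbauer ν i).eval ⟪x, z⟫ * ⟪y, z⟫ ^ (b - 1))
          - (i + b) * (⟪x, z⟫ * ((gegenbauer ν i).eval ⟪x, z⟫ * ⟪y, z⟫ ^ b)) := by
      intro z
      rw [one_sub_sq_mul_derivative_gegenbauer hν]
      cases b with
      | zero => simp; ring
      | succ b => simp; ring
    simp only [e] at h
    have hX : Integrable (fun z => ⟪x, z⟫ * ((gegenbauer ν i).eval ⟪x, z⟫ * ⟪y, z⟫ ^ b)) σ :=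
      integrable_of_continuous_of_sphere hσ (by fun_prop)
    rw [integral_sub (integrable_of_continuous_of_sphere hσ (by fun_prop)) (hX.const_mul _),
      integral_add ((hInt _ _).const_mul _) ((hInt _ _).const_mul _), integral_const_mul,
      integral_const_mul, integral_const_mul, hn] at h
    simp only [eval_pow, eval_X] at h
    have hr : (i + ν) * ∫ z, (gegenbauer ν (i + 1)).eval ⟪x, z⟫ * ⟪y, z⟫ ^ b ∂σ
        = (2 * i + ν) * (∫ z, ⟪x, z⟫ * ((gegenbauer ν i).eval ⟪x, z⟫ * ⟪y, z⟫ ^ b) ∂σ)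
          - i * ∫ z, (gegenbauer ν (i - 1)).eval ⟪x, z⟫ * ⟪y, z⟫ ^ b ∂σ := by
      rw [← integral_const_mul, ← integral_const_mul, ← integral_const_mul,
        ← integral_sub (hX.const_mul _) ((hInt _ _).const_mul _)]
      refine integral_congr_ae (Filter.Eventually.of_forall fun z => ?_)
      simp only
      rw [← mul_assoc, eval_gegenbauer_rec hν]
      ring
    linear_combination (ν + 1 + b + i) * hr + (2 * i + ν) * h
  induction i using Nat.strong_induction_on generalizing b with
  | _ i ih =>
    match i with
    | 0 => simpa [gegenbauer, funkHeckeCoeff] using integral_pow_sphere hν hn hσ hinv hy b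
    | i + 1 =>
      have h := key i b
      rw [ih i (by omega)] at h
      have hr := eval_gegenbauer_rec hν i ⟪x, y⟫
      have h0 : (ν + 1 + b + i) * (i + ν) ≠ 0 := by positivity
      refine mul_left_cancel₀ h0 (h.trans ?_)
      rw [funkHeckeCoeff]
      have h1 : ν + 1 + b + i ≠ 0 := by positivity
      field_simp
      cases i with
      | zero =>
        simp at hr ⊢
        linear_combination -b * funkHeckeCoeff ν 0 (b - 1) * hr
      | succ i =>
        rw [Nat.add_sub_cancel, ih i (by omega)]
        rw [Nat.add_sub_cancel] at hr
        have hc := funkHeckeCoeff_consistent hν i b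
        push_cast at hr ⊢
        linear_combination -b * funkHeckeCoeff ν (i + 1) (b - 1) * hr
          - (i + 1) * (gegenbauer ν i).eval ⟪x, y⟫ * hc

/-- The Funk–Hecke formula. -/
lemma integral_gegenbauer_mul [IsProbabilityMeasure σ] {ν : ℝ} (hν : 0 < ν)
    (hn : (Module.finrank ℝ E : ℝ) = ν + 2)
    (hσ : ∀ᵐ z ∂σ, ‖z‖ = 1) (hinv : ∀ U : E ≃ₗᵢ[ℝ] E, MeasurePreserving U σ σ)
    {x y : E} (hx : ‖x‖ = 1) (hy : ‖y‖ = 1) (i : ℕ) (p : ℝ[X]) :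
    ∫ z, (gegenbauer ν i).eval ⟪x, z⟫ * p.eval ⟪y, z⟫ ∂σ
      = (p.sum fun b a => a * funkHeckeCoeff ν i b) * (gegenbauer ν i).eval ⟪x, y⟫ := by
  simp only [eval_eq_sum (p := p), Polynomial.sum, Finset.mul_sum, Finset.sum_mul]
  rw [integral_finsetSum _ fun b _ => integrable_of_continuous_of_sphere hσ (by fun_prop)]
  refine Finset.sum_congr rfl fun b _ => ?_
  rw [mul_assoc, ← integral_gegenbauer_mul_pow hν hn hσ hinv hx hy, ← integral_const_mul]
  exact integral_congr_ae (Filter.Eventually.of_forall fun z => by simp only; ring)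

lemma integral_gegenbauer_mul_eq_zero [IsProbabilityMeasure σ] {ν : ℝ} (hν : 0 < ν)
    (hn : (Module.finrank ℝ E : ℝ) = ν + 2)
    (hσ : ∀ᵐ z ∂σ, ‖z‖ = 1) (hinv : ∀ U : E ≃ₗᵢ[ℝ] E, MeasurePreserving U σ σ)
    {x y : E} (hx : ‖x‖ = 1) (hy : ‖y‖ = 1) {i : ℕ} {p : ℝ[X]} (hp : p.natDegree < i) :
    ∫ z, (gegenbauer ν i).eval ⟪x, z⟫ * p.eval ⟪y, z⟫ ∂σ = 0 := by
  rw [integral_gegenbauer_mul hν hn hσ hinv hx hy, Polynomial.sum, Finset.sum_eq_zero, zero_mul]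
  intro b hb
  rw [funkHeckeCoeff_eq_zero ν ((le_natDegree_of_mem_supp b hb).trans_lt hp), mul_zero]

/-- The zonal Gegenbauer kernels reproduce themselves up to a scalar. -/
lemma integral_gegenbauer_mul_self [IsProbabilityMeasure σ] {ν : ℝ} (hν : 0 < ν)
    (hn : (Module.finrank ℝ E : ℝ) = ν + 2)
    (hσ : ∀ᵐ z ∂σ, ‖z‖ = 1) (hinv : ∀ U : E ≃ₗᵢ[ℝ] E, MeasurePreserving U σ σ)
    {x y : E} (hx : ‖x‖ = 1) (hy : ‖y‖ = 1) (i : ℕ) :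
    ∫ z, (gegenbauer ν i).eval ⟪x, z⟫ * (gegenbauer ν i).eval ⟪y, z⟫ ∂σ
      = (gegenbauer ν i).eval ⟪x, y⟫ / gegenbauerWeight ν i := by
  have hInt : ∀ p q : ℝ[X], Integrable (fun z => p.eval ⟪x, z⟫ * q.eval ⟪x, z⟫) σ := fun p q =>
    integrable_of_continuous_of_sphere hσ (by fun_prop)
  have hxx : ⟪x, x⟫ = 1 := by rw [real_inner_self_eq_norm_sq, hx, one_pow]
  have diag : ∫ z, (gegenbauer ν i).eval ⟪x, z⟫ * (gegenbauer ν i).eval ⟪x, z⟫ ∂σ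
      = 1 / gegenbauerWeight ν i := by
    induction i with
    | zero => simp [gegenbauer, gegenbauerWeight]
    | succ i ih =>
      let J : ℝ :=
        ∫ z, ⟪x, z⟫ * ((gegenbauer ν i).eval ⟪x, z⟫ * (gegenbauer ν (i + 1)).eval ⟪x, z⟫) ∂σ
      have h1 : (2 * i + ν) * J = (i + ν) *
          ∫ z, (gegenbauer ν (i + 1)).eval ⟪x, z⟫ * (gegenbauer ν (i + 1)).eval ⟪x, z⟫ ∂σ := by
        have h0 := integral_gegenbauer_mul_eq_zero hν hn hσ hinv hx hx (i := i + 1)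
          (p := gegenbauer ν (i - 1)) ((natDegree_gegenbauer_le ν _).trans_lt (by omega))
        rw [← add_zero ((i + ν) * _), ← mul_zero (i : ℝ), ← h0, ← integral_const_mul,
          ← integral_const_mul, ← integral_const_mul,
          ← integral_add ((hInt _ _).const_mul _) ((hInt _ _).const_mul _)]
        refine integral_congr_ae (Filter.Eventually.of_forall fun z => ?_)
        simp only
        linear_combination (-(gegenbauer ν (i + 1)).eval ⟪x, z⟫) * eval_gegenbauer_rec hν i ⟪x, z⟫
      have h2 : (2 * (i + 1) + ν) * J = (i + 1) *
          ∫ z, (gegenbauer ν i).eval ⟪x, z⟫ * (gegenbauer ν i).eval ⟪x, z⟫ ∂σ := by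
        have h0 := integral_gegenbauer_mul_eq_zero hν hn hσ hinv hx hx (i := i + 2)
          (p := gegenbauer ν i) ((natDegree_gegenbauer_le ν _).trans_lt (by omega))
        rw [← add_zero (((i : ℝ) + 1) * _), ← mul_zero ((i : ℝ) + 1 + ν), ← h0,
          ← integral_const_mul, ← integral_const_mul, ← integral_const_mul,
          ← integral_add ((hInt _ _).const_mul _) ((hInt _ _).const_mul _)]
        refine integral_congr_ae (Filter.Eventually.of_forall fun z => ?_)
        have hr := eval_gegenbauer_rec hν (i + 1) ⟪x, z⟫
        rw [Nat.add_sub_cancel] at hr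
        push_cast at hr
        simp only
        linear_combination (-(gegenbauer ν i).eval ⟪x, z⟫) * hr
      rw [ih] at h2
      have hw := gegenbauerWeight_pos hν i
      rw [gegenbauerWeight]
      have e1 : (2 * (i : ℝ) + ν) ≠ 0 := by positivity
      have e2 : ((i : ℝ) + ν) ≠ 0 := by positivity
      have e3 : (2 * (i : ℝ) + 2 + ν) ≠ 0 := by positivity
      have hJ : J = (i + 1) / ((2 * i + 2 + ν) * gegenbauerWeight ν i) := by
        field_simp at h2 ⊢
        linear_combination h2
      rw [hJ] at h1
      field_simp at h1 ⊢
      linear_combination -h1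
  have hxy := integral_gegenbauer_mul hν hn hσ hinv hx hy i (gegenbauer ν i)
  have hxx' := integral_gegenbauer_mul hν hn hσ hinv hx hx i (gegenbauer ν i)
  rw [diag, hxx, eval_one_gegenbauer hν, mul_one] at hxx'
  rw [hxy, ← hxx']
  ring
end

section
open Polynomial
variable {E : Type*} [NormedAddCommGroup E] [InnerProductSpace ℝ E] [FiniteDimensional ℝ E]

/-- Gegenbauer polynomials are positive definite functions on the sphere. -/
lemma sum_mul_gegenbauer_nonneg {ν : ℝ} (hν : 0 < ν)
    (hn : (Module.finrank ℝ E : ℝ) = ν + 2) {ι : Type*} [Fintype ι] {v : ι → E}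
    (hv : ∀ a, ‖v a‖ = 1) (c : ι → ℝ) (i : ℕ) :
    0 ≤ ∑ a, ∑ b, c a * c b * (gegenbauer ν i).eval ⟪v a, v b⟫ := by
  borelize E
  have : Nontrivial E := Module.nontrivial_of_finrank_pos (R := ℝ) (by
    rw [← Nat.cast_pos (α := ℝ), hn]; positivity)
  obtain ⟨σ, hprob, hσ, hinv⟩ := exists_invariant_sphere_measure E
  have hsq : ∫ z, (∑ a, c a * (gegenbauer ν i).eval ⟪v a, z⟫) ^ 2 ∂σ
      = (∑ a, ∑ b, c a * c b * (gegenbauer ν i).eval ⟪v a, v b⟫) / gegenbauerWeight ν i := by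
    simp only [pow_two, Finset.sum_mul_sum, Finset.sum_div]
    rw [integral_finsetSum _ fun a _ => integrable_of_continuous_of_sphere hσ (by fun_prop)]
    refine Finset.sum_congr rfl fun a _ => ?_
    rw [integral_finsetSum _ fun b _ => integrable_of_continuous_of_sphere hσ (by fun_prop)]
    refine Finset.sum_congr rfl fun b _ => ?_
    rw [mul_div_assoc, ← integral_gegenbauer_mul_self hν hn hσ hinv (hv a) (hv b),
      ← integral_const_mul]
    exact integral_congr_ae (Filter.Eventually.of_forall fun z => by simp only; ring)
  have h0 : 0 ≤ ∫ z, (∑ a, c a * (gegenbauer ν i).eval ⟪v a, z⟫) ^ 2 ∂σ :=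
    integral_nonneg fun z => sq_nonneg _
  rwa [hsq, le_div_iff₀ (gegenbauerWeight_pos hν i), zero_mul] at h0

lemma sum_gegenbauer_mul_gegenbauer_nonneg {ν : ℝ} (hν : 0 < ν)
    (hn : (Module.finrank ℝ E : ℝ) = ν + 2) {ι : Type*} [Fintype ι] {v : ι → E}
    (hv : ∀ a, ‖v a‖ = 1) (i j : ℕ) :
    0 ≤ ∑ a, ∑ b, (gegenbauer ν i).eval ⟪v a, v b⟫ * (gegenbauer ν j).eval ⟪v a, v b⟫ := by
  borelize E
  have : Nontrivial E := Module.nontrivial_of_finrank_pos (R := ℝ) (by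
    rw [← Nat.cast_pos (α := ℝ), hn]; positivity)
  obtain ⟨σ, hprob, hσ, hinv⟩ := exists_invariant_sphere_measure E
  have hInt : ∫ z, (∑ a, ∑ b, (gegenbauer ν i).eval ⟪v a, z⟫ * (gegenbauer ν i).eval ⟪v b, z⟫
        * (gegenbauer ν j).eval ⟪v a, v b⟫) ∂σ
      = (∑ a, ∑ b, (gegenbauer ν i).eval ⟪v a, v b⟫ * (gegenbauer ν j).eval ⟪v a, v b⟫)
        / gegenbauerWeight ν i := by
    rw [integral_finsetSum _ fun a _ => integrable_of_continuous_of_sphere hσ (by fun_prop),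
      Finset.sum_div]
    refine Finset.sum_congr rfl fun a _ => ?_
    rw [integral_finsetSum _ fun b _ => integrable_of_continuous_of_sphere hσ (by fun_prop),
      Finset.sum_div]
    refine Finset.sum_congr rfl fun b _ => ?_
    rw [integral_mul_const, integral_gegenbauer_mul_self hν hn hσ hinv (hv a) (hv b),
      div_mul_eq_mul_div]
  refine (zero_mul _).symm.trans_le ((le_div_iff₀ (gegenbauerWeight_pos hν i)).1 ?_)
  rw [← hInt]
  exact integral_nonneg fun z =>
    sum_mul_gegenbauer_nonneg hν hn hv (fun a => (gegenbauer ν i).eval ⟪v a, z⟫) j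

lemma card_sq_div_le_sum_gegenbauer_sq {ν : ℝ} (hν : 0 < ν)
    (hn : (Module.finrank ℝ E : ℝ) = ν + 2) {ι : Type*} [Fintype ι] {v : ι → E}
    (hv : ∀ a, ‖v a‖ = 1) (i : ℕ) :
    (Fintype.card ι : ℝ) ^ 2 / gegenbauerWeight ν i
      ≤ ∑ a, ∑ b, (gegenbauer ν i).eval ⟪v a, v b⟫ ^ 2 := by
  borelize E
  have : Nontrivial E := Module.nontrivial_of_finrank_pos (R := ℝ) (by
    rw [← Nat.cast_pos (α := ℝ), hn]; positivity)
  obtain ⟨σ, hprob, hσ, hinv⟩ := exists_invariant_sphere_measure E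
  have hw := gegenbauerWeight_pos hν i
  have hself : ∀ {z : E}, ‖z‖ = 1 → (gegenbauer ν i).eval ⟪z, z⟫ = 1 := fun hz => by
    rw [real_inner_self_eq_norm_sq, hz, one_pow, eval_one_gegenbauer hν]
  set d : ℝ := Fintype.card ι / gegenbauerWeight ν i with hd
  have hpt : ∀ᵐ z ∂σ, 0 ≤ (∑ a, ∑ b, (gegenbauer ν i).eval ⟪v a, z⟫
      * (gegenbauer ν i).eval ⟪v b, z⟫ * (gegenbauer ν i).eval ⟪v a, v b⟫)
      - 2 * d * (∑ a, (gegenbauer ν i).eval ⟪v a, z⟫ * (gegenbauer ν i).eval ⟪v a, z⟫)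
      + d ^ 2 := by
    filter_upwards [hσ] with z hz
    have h := sum_mul_gegenbauer_nonneg hν hn (ι := Option ι) (v := fun o => o.elim z v)
      (by rintro (_ | a); exacts [hz, hv a])
      (fun o => o.elim (-d) fun a => (gegenbauer ν i).eval ⟪v a, z⟫) i
    simp only [Fintype.sum_option, Option.elim, hself hz, Finset.sum_add_distrib] at h
    refine h.trans_eq ?_
    simp only [real_inner_comm _ z, Finset.mul_sum]
    rw [Finset.sum_congr rfl fun a _ => show 2 * d * ((gegenbauer ν i).eval ⟪v a, z⟫
      * (gegenbauer ν i).eval ⟪v a, z⟫) = -(-d * (gegenbauer ν i).eval ⟪v a, z⟫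
      * (gegenbauer ν i).eval ⟪v a, z⟫) - (gegenbauer ν i).eval ⟪v a, z⟫ * -d
      * (gegenbauer ν i).eval ⟪v a, z⟫ by ring, Finset.sum_sub_distrib, Finset.sum_neg_distrib]
    simp only [real_inner_comm z]
    ring
  have h0 := integral_nonneg_of_ae hpt
  have e1 : ∫ z, (∑ a, ∑ b, (gegenbauer ν i).eval ⟪v a, z⟫
      * (gegenbauer ν i).eval ⟪v b, z⟫ * (gegenbauer ν i).eval ⟪v a, v b⟫) ∂σ
      = (∑ a, ∑ b, (gegenbauer ν i).eval ⟪v a, v b⟫ ^ 2) / gegenbauerWeight ν i := by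
    rw [integral_finsetSum _ fun a _ => integrable_of_continuous_of_sphere hσ (by fun_prop),
      Finset.sum_div]
    refine Finset.sum_congr rfl fun a _ => ?_
    rw [integral_finsetSum _ fun b _ => integrable_of_continuous_of_sphere hσ (by fun_prop),
      Finset.sum_div]
    refine Finset.sum_congr rfl fun b _ => ?_
    rw [integral_mul_const, integral_gegenbauer_mul_self hν hn hσ hinv (hv a) (hv b),
      div_mul_eq_mul_div, pow_two]
  have e2 : ∫ z, (∑ a, (gegenbauer ν i).eval ⟪v a, z⟫ * (gegenbauer ν i).eval ⟪v a, z⟫) ∂σ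
      = d := by
    rw [integral_finsetSum _ fun a _ => integrable_of_continuous_of_sphere hσ (by fun_prop)]
    simp only [integral_gegenbauer_mul_self hν hn hσ hinv (hv _) (hv _), hself (hv _)]
    simp [hd, div_eq_mul_inv]
  rw [integral_add (integrable_of_continuous_of_sphere hσ (by fun_prop)) (integrable_const _),
    integral_sub (integrable_of_continuous_of_sphere hσ (by fun_prop))
      (integrable_of_continuous_of_sphere hσ (by fun_prop)), integral_const_mul, e1, e2] at h0
  simp only [integral_const, probReal_univ, one_smul] at h0
  have h1 : d ^ 2 ≤ (∑ a, ∑ b, (gegenbauer ν i).eval ⟪v a, v b⟫ ^ 2) / gegenbauerWeight ν i := by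
    linarith
  rw [hd, le_div_iff₀ hw] at h1
  refine le_trans (le_of_eq ?_) h1
  field_simp
end

section
variable {E : Type*} [NormedAddCommGroup E] [InnerProductSpace ℝ E] [FiniteDimensional ℝ E]

/-- The `i`-th off-diagonal entry of the Jacobi matrix of the orthonormal Gegenbauer polynomials. -/
noncomputable def gegenbauerJacobi (ν : ℝ) (i : ℕ) : ℝ :=
  Real.sqrt ((ν + i) * (i + 1) / ((ν + 2 + 2 * i) * (ν + 2 * i)))

lemma gegenbauerJacobi_pos {ν : ℝ} (hν : 0 < ν) (i : ℕ) : 0 < gegenbauerJacobi ν i :=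
  Real.sqrt_pos.2 (by positivity)

lemma gegenbauerJacobi_sq {ν : ℝ} (hν : 0 < ν) (i : ℕ) :
    gegenbauerJacobi ν i ^ 2 = (ν + i) * (i + 1) / ((ν + 2 + 2 * i) * (ν + 2 * i)) :=
  Real.sq_sqrt (by positivity)

lemma gegenbauerJacobi_mul_sqrt_weight_succ {ν : ℝ} (hν : 0 < ν) (i : ℕ) :
    gegenbauerJacobi ν i * √(gegenbauerWeight ν (i + 1))
      = √(gegenbauerWeight ν i) * ((ν + i) / (ν + 2 * i)) := by
  have h0 := gegenbauerWeight_pos hν i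
  have ha := gegenbauerJacobi_pos hν i
  rw [← sq_eq_sq₀ (by positivity) (by positivity), mul_pow, mul_pow, gegenbauerJacobi_sq hν,
    Real.sq_sqrt h0.le, Real.sq_sqrt (gegenbauerWeight_pos hν _).le, gegenbauerWeight]
  have e1 : ν + 2 * (i : ℝ) ≠ 0 := by positivity
  have e2 : 2 * (i : ℝ) + ν ≠ 0 := by positivity
  have e3 : ν + 2 + 2 * (i : ℝ) ≠ 0 := by positivity
  field_simp
  ring

lemma gegenbauerJacobi_mul_sqrt_weight {ν : ℝ} (hν : 0 < ν) (i : ℕ) :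
    gegenbauerJacobi ν i * √(gegenbauerWeight ν i)
      = √(gegenbauerWeight ν (i + 1)) * ((i + 1) / (ν + 2 + 2 * i)) := by
  have h0 := gegenbauerWeight_pos hν i
  have ha := gegenbauerJacobi_pos hν i
  rw [← sq_eq_sq₀ (by positivity) (by positivity), mul_pow, mul_pow, gegenbauerJacobi_sq hν,
    Real.sq_sqrt h0.le, Real.sq_sqrt (gegenbauerWeight_pos hν _).le, gegenbauerWeight]
  have e1 : ν + 2 * (i : ℝ) ≠ 0 := by positivity
  have e2 : 2 * (i : ℝ) + ν ≠ 0 := by positivity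
  have e3 : ν + 2 + 2 * (i : ℝ) ≠ 0 := by positivity
  field_simp
  ring

/-- The three-term recurrence of the orthonormal Gegenbauer polynomials. -/
lemma mul_orthonormal_gegenbauer {ν : ℝ} (hν : 0 < ν) (s : ℝ) (i : ℕ) :
    s * (√(gegenbauerWeight ν i) * (gegenbauer ν i).eval s)
      = gegenbauerJacobi ν i * (√(gegenbauerWeight ν (i + 1)) * (gegenbauer ν (i + 1)).eval s)
        + if 0 < i then gegenbauerJacobi ν (i - 1)
          * (√(gegenbauerWeight ν (i - 1)) * (gegenbauer ν (i - 1)).eval s) else 0 := by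
  have hr := eval_gegenbauer_rec hν i s
  rw [← mul_assoc (gegenbauerJacobi ν i), gegenbauerJacobi_mul_sqrt_weight_succ hν]
  have e1 : ν + 2 * (i : ℝ) ≠ 0 := by positivity
  cases i with
  | zero =>
    simp only [lt_irrefl, if_false]
    field_simp
    push_cast at hr ⊢
    linear_combination -√(gegenbauerWeight ν 0) * hr
  | succ i =>
    rw [if_pos i.succ_pos, Nat.add_sub_cancel, ← mul_assoc (gegenbauerJacobi ν i),
      gegenbauerJacobi_mul_sqrt_weight hν]
    rw [Nat.add_sub_cancel] at hr
    have e2 : ν + 2 + 2 * (i : ℝ) ≠ 0 := by positivity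
    push_cast at hr e1 ⊢
    have e3 : ν + 2 * ((i : ℝ) + 1) = ν + 2 + 2 * i := by ring
    rw [e3]
    field_simp
    linear_combination -√(gegenbauerWeight ν (i + 1)) * hr

lemma sum_mul_sum_gegenbauer_nonneg {ν : ℝ} (hν : 0 < ν)
    (hn : (Module.finrank ℝ E : ℝ) = ν + 2) {ι : Type*} [Fintype ι] {v : ι → E}
    (hv : ∀ a, ‖v a‖ = 1) {m : ℕ} {c : Fin m → ℝ} (hc : 0 ≤ c) (j : ℕ) :
    0 ≤ ∑ a, ∑ b, (gegenbauer ν j).eval ⟪v a, v b⟫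
      * ∑ i : Fin m, c i * (gegenbauer ν i).eval ⟪v a, v b⟫ := by
  have : ∑ a, ∑ b, (gegenbauer ν j).eval ⟪v a, v b⟫
      * ∑ i : Fin m, c i * (gegenbauer ν i).eval ⟪v a, v b⟫
      = ∑ i : Fin m, c i * ∑ a, ∑ b,
        (gegenbauer ν j).eval ⟪v a, v b⟫ * (gegenbauer ν i).eval ⟪v a, v b⟫ := by
    simp only [Finset.mul_sum]
    rw [Finset.sum_congr rfl fun a _ => Finset.sum_comm, Finset.sum_comm]
    exact Finset.sum_congr rfl fun i _ => Finset.sum_congr rfl fun a _ =>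
      Finset.sum_congr rfl fun b _ => by ring
  rw [this]
  exact Finset.sum_nonneg fun i _ =>
    mul_nonneg (hc i) (sum_gegenbauer_mul_gegenbauer_nonneg hν hn hv j i)

lemma card_mul_one_sub_maxEig_le {ν : ℝ} (hν : 0 < ν)
    (hn : (Module.finrank ℝ E : ℝ) = ν + 2) {ι : Type*} [Fintype ι] {v : ι → E}
    (hv : ∀ a, ‖v a‖ = 1) {t : ℝ} (ht : ∀ a b, a ≠ b → ⟪v a, v b⟫ ≤ t) (m : ℕ)
    (h1 : t ≤ maxEig (Tridiag m (fun _ => 0) (gegenbauerJacobi ν)))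
    (h2 : maxEig (Tridiag (m + 1) (fun _ => 0) (gegenbauerJacobi ν)) < 1) :
    Fintype.card ι * (1 - maxEig (Tridiag (m + 1) (fun _ => 0) (gegenbauerJacobi ν)))
      ≤ 4 * (gegenbauerWeight ν (m + 1) * (((m + 1 : ℕ) + ν) / (2 * (m + 1 : ℕ) + ν))) := by
  classical
  set k := m + 1
  set ρ : ℝ := (ν + k) / (ν + 2 * k) with hρ
  have hρ0 : 0 < ρ := by positivity
  set T := Tridiag k (fun i => if i = k then -ρ else 0) (gegenbauerJacobi ν) with hT
  set l := maxEig T with hl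
  have htl : t ≤ l := h1.trans (maxEig_Tridiag_le_succ m _ _ _ fun i hi => by
    rw [if_neg (by omega)])
  have hlS : l ≤ maxEig (Tridiag k (fun _ => 0) (gegenbauerJacobi ν)) :=
    maxEig_Tridiag_mono k _ _ _ fun i => by split_ifs <;> linarith
  have hl1 : l < 1 := hlS.trans_lt h2
  obtain ⟨f, hf0, hf, hfe⟩ := exists_nonneg_maxEig_eigenvector (Tridiag_isHermitian k _ _)
    (M := T) (by
      intro i j hij
      simp only [hT, Tridiag, Matrix.of_apply, Fin.val_eq_val, hij, if_false]
      split_ifs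
      exacts [(gegenbauerJacobi_pos hν _).le, (gegenbauerJacobi_pos hν _).le, le_rfl])
  let w : ℕ → ℝ := fun i => √(gegenbauerWeight ν i)
  have hw : ∀ i, 0 < w i := fun i => Real.sqrt_pos.2 (gegenbauerWeight_pos hν i)
  have hw2 : ∀ i, w i ^ 2 = gegenbauerWeight ν i := fun i =>
    Real.sq_sqrt (gegenbauerWeight_pos hν i).le
  let G : ℕ → ℝ → ℝ := fun i s => (gegenbauer ν i).eval s
  let U : ℝ → ℝ := fun s => ∑ i : Fin (k + 1), f i * w i * G i s
  have hU : ∀ s, (s - l) * U s = f (Fin.last k) * w k * ρ * (G (k + 1) s + G k s) := by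
    intro s
    have h := sub_eigenvalue_mul_sum (x := s)
      (P := fun i => √(gegenbauerWeight ν i) * (gegenbauer ν i).eval s)
      (mul_orthonormal_gegenbauer hν s) hfe
    simp only [← mul_assoc] at h
    refine h.trans ?_
    rw [gegenbauerJacobi_mul_sqrt_weight_succ hν]
    ring
  have hG1 : ∀ i, G i 1 = 1 := eval_one_gegenbauer hν
  have hU1 : U 1 = ∑ i : Fin (k + 1), f i * w i := by simp only [U, hG1, mul_one]
  have hU1pos : 0 < U 1 := by
    rw [hU1]
    obtain ⟨i, hi⟩ := Function.ne_iff.1 hf0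
    exact Finset.sum_pos' (fun j _ => mul_nonneg (hf j) (hw j).le)
      ⟨i, Finset.mem_univ _, mul_pos (lt_of_le_of_ne (hf i) (Ne.symm hi)) (hw i)⟩
  set q := f (Fin.last k) with hq
  have hlast := hU 1
  rw [hG1, hG1] at hlast
  have hqpos : 0 < q := by
    refine lt_of_le_of_ne (hf _) fun h => ?_
    rw [← h] at hlast
    have := mul_pos (sub_pos.2 hl1) hU1pos
    linarith
  have hinner : ∀ a, ⟪v a, v a⟫ = 1 := fun a => by rw [real_inner_self_eq_norm_sq, hv, one_pow]
  have hupper : ∑ a, ∑ b, (⟪v a, v b⟫ - l) * U ⟪v a, v b⟫ ^ 2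
      ≤ Fintype.card ι * ((1 - l) * U 1 ^ 2) := by
    rw [← nsmul_eq_mul, ← Finset.card_univ]
    refine Finset.sum_le_card_nsmul _ _ _ fun a _ => ?_
    rw [← Finset.sum_erase_add _ _ (Finset.mem_univ a), hinner]
    refine add_le_of_nonpos_left (Finset.sum_nonpos fun b hb => ?_)
    have := ht a b (Finset.ne_of_mem_erase hb).symm
    exact mul_nonpos_of_nonpos_of_nonneg (by linarith) (sq_nonneg _)
  have hlower : ρ * q ^ 2 * Fintype.card ι ^ 2
      ≤ ∑ a, ∑ b, (⟪v a, v b⟫ - l) * U ⟪v a, v b⟫ ^ 2 := by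
    have e : ∀ s, (s - l) * U s ^ 2 = q * w k * ρ * (G (k + 1) s * U s)
        + q * w k * ρ * (G k s * ∑ i : Fin k, f i.castSucc * w i * G i s)
        + ρ * q ^ 2 * w k ^ 2 * G k s ^ 2 := by
      intro s
      have : U s = (∑ i : Fin k, f i.castSucc * w i * G i s) + q * w k * G k s := by
        simp only [U, Fin.sum_univ_castSucc, Fin.val_castSucc, Fin.val_last]
        rfl
      rw [pow_two, ← mul_assoc, hU]
      linear_combination q * w k * ρ * G k s * this
    simp only [e, Finset.sum_add_distrib, ← Finset.mul_sum]
    have i1 := sum_mul_sum_gegenbauer_nonneg hν hn hv (c := fun i : Fin (k + 1) => f i * w i)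
      (fun i => mul_nonneg (hf i) (hw i).le) (k + 1)
    have i2 := sum_mul_sum_gegenbauer_nonneg hν hn hv (c := fun i : Fin k => f i.castSucc * w i)
      (fun i => mul_nonneg (hf _) (hw i).le) k
    have i3 := card_sq_div_le_sum_gegenbauer_sq hν hn hv k
    have hc : 0 ≤ q * w k * ρ := by have := hw k; positivity
    have j1 := mul_nonneg hc i1
    have j2 := mul_nonneg hc i2
    have j3 := mul_le_mul_of_nonneg_left i3 (show 0 ≤ ρ * q ^ 2 * w k ^ 2 by positivity)
    rw [show ρ * q ^ 2 * w k ^ 2 * ((Fintype.card ι : ℝ) ^ 2 / gegenbauerWeight ν k)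
      = ρ * q ^ 2 * Fintype.card ι ^ 2 by
        rw [hw2]; have := (gegenbauerWeight_pos hν k).ne'; field_simp] at j3
    exact j3.trans (le_add_of_nonneg_left (add_nonneg j1 j2))
  have hmain := hlower.trans hupper
  have hwk := hw k
  have hgoal : (Fintype.card ι : ℝ) * (1 - l) ≤ 4 * (w k ^ 2 * ρ) := by
    rcases (Nat.cast_nonneg (α := ℝ) (Fintype.card ι)).eq_or_lt with h0 | h0
    · rw [← h0, zero_mul]; positivity
    · refine le_of_mul_le_mul_left ?_ (show 0 < ρ * q ^ 2 * Fintype.card ι by positivity)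
      have := mul_le_mul_of_nonneg_right hmain (sub_pos.2 hl1).le
      have hsq : ((1 - l) * U 1) ^ 2 = 4 * (q * w k * ρ) ^ 2 := by rw [hlast]; ring
      linear_combination this + Fintype.card ι * hsq
  rw [hw2] at hgoal
  have hle : (Fintype.card ι : ℝ) * (1 - maxEig (Tridiag k (fun _ => 0) (gegenbauerJacobi ν)))
      ≤ Fintype.card ι * (1 - l) := by gcongr
  refine hle.trans (hgoal.trans_eq ?_)
  rw [hρ, add_comm ν, add_comm ν]
end
end

open RealInnerProductSpace

/-- Theorem 5: the spectral bound (11) for spherical codes. -/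
theorem spherical_code_spectral_bound (n k : ℕ) (hn : 3 ≤ n) (hk : 1 ≤ k)
    (t : ℝ) (ht1 : -1 < t) (ht2 : t < 1)
    (aG : ℕ → ℝ)
    (haG : aG = fun i : ℕ => Real.sqrt (((n : ℝ) + i - 2) * ((i : ℝ) + 1)
      / (((n : ℝ) + 2 * i) * ((n : ℝ) + 2 * i - 2))))
    (hcond1 : t ≤ maxEig (Tridiag (k - 1) (fun _ => 0) aG))
    (hcond2 : maxEig (Tridiag k (fun _ => 0) aG) < 1)
    (C : Finset (EuclideanSpace ℝ (Fin n)))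
    (hunit : ∀ x ∈ C, ‖x‖ = 1)
    (hangle : ∀ x ∈ C, ∀ y ∈ C, x ≠ y → ⟪x, y⟫ ≤ t) :
    (C.card : ℝ)
      ≤ 4 * (Nat.choose (n + k - 2) k) / (1 - maxEig (Tridiag k (fun _ => 0) aG)) := by
  obtain ⟨m, rfl⟩ : ∃ m, n = m + 2 := ⟨n - 2, by omega⟩
  obtain ⟨k, rfl⟩ : ∃ j, k = j + 1 := ⟨k - 1, by omega⟩
  have hm : 0 < m := by omega
  have ha : aG = gegenbauerJacobi m := by
    rw [haG]
    funext i
    rw [gegenbauerJacobi]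
    push_cast
    ring_nf
  rw [ha] at hcond1 hcond2 ⊢
  have h := card_mul_one_sub_maxEig_le (E := EuclideanSpace ℝ (Fin (m + 2))) (ν := m)
    (by exact_mod_cast hm) (by simp) (ι := C) (v := Subtype.val) (fun x => hunit x x.2)
    (fun x y hxy => hangle x x.2 y y.2 (Subtype.coe_injective.ne hxy)) k hcond1 hcond2
  rw [gegenbauerWeight_mul m hm, Fintype.card_coe] at h
  rw [le_div_iff₀ (sub_pos.2 hcond2), show m + 2 + (k + 1) - 2 = m + (k + 1) by omega]
  exact h
end

section
/- Let n ≥ 5 and k ≥ 2, and let S_k be the (k+1)×(k+1) symmetric tridiagonal matrix with zero diagonal and off-diagonal entries a_i = √((n+i−2)(i+1)/((n+2i)(n+2i−2))) for i = 0,…,k−1. Then for every s = 2,…,k: (2(s−1)/s)·√((n+k−s−1)(k−s+2)/((n+2k−2s+2)(n+2k−2s))) ≤ λmax(S_k) ≤ 2·√((n+k−3)k/((n+2k−2)(n+2k−4))). Moreover, if (n_j) and (k_j) are sequences of positive integers with n_j → ∞ and k_j/n_j → ρ for some ρ > 0, then λmax(S_{k_j}) → 2√(ρ(1+ρ))/(1+2ρ).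 -/
open Filter

open Matrix in
theorem tridiag_zero_isHermitian (k : ℕ) (o : ℕ → ℝ) :
    (Tridiag k (fun _ => 0) o).IsHermitian := by
  ext i j
  simp only [Tridiag, conjTranspose_apply, of_apply, star_trivial]
  split_ifs <;> first | rfl | omega

open Matrix in
/-- The quadratic form of a tridiagonal matrix with zero diagonal. -/
theorem dotProduct_tridiag_zero_mulVec (k : ℕ) (o : ℕ → ℝ) (x : Fin (k + 1) → ℝ) :
    x ⬝ᵥ (Tridiag k (fun _ => 0) o *ᵥ x)
      = 2 * ∑ i : Fin k, o i * (x i.castSucc * x i.succ) := by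
  let u : Fin (k + 1) → Fin (k + 1) → ℝ := fun i j =>
    if (i : ℕ) + 1 = j then o i * (x i * x j) else 0
  have hu : ∑ i, ∑ j, u i j = ∑ i : Fin k, o i * (x i.castSucc * x i.succ) := by
    rw [Fin.sum_univ_castSucc]
    have hlast : ∑ j, u (Fin.last k) j = 0 := by
      refine Finset.sum_eq_zero fun j _ => if_neg ?_
      have := j.isLt
      simp only [Fin.val_last]
      omega
    rw [hlast, add_zero]
    refine Finset.sum_congr rfl fun i _ => ?_
    rw [Finset.sum_eq_single i.succ]
    · simp [u]
    · intro j _ hj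
      refine if_neg fun h => hj (Fin.ext ?_)
      simpa using h.symm
    · simp
  have hsplit : x ⬝ᵥ (Tridiag k (fun _ => 0) o *ᵥ x) = ∑ i, ∑ j, (u i j + u j i) := by
    simp only [dotProduct, mulVec, Finset.mul_sum]
    refine Finset.sum_congr rfl fun i _ => Finset.sum_congr rfl fun j _ => ?_
    simp only [Tridiag, of_apply, u]
    split_ifs <;> first | omega | ring
  rw [hsplit]
  simp only [Finset.sum_add_distrib]
  rw [Finset.sum_comm (f := fun i j => u j i), hu]
  ring

theorem bddAbove_hasEigenvalue {m : ℕ} (M : Matrix (Fin m) (Fin m) ℝ) :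
    BddAbove {μ : ℝ | Module.End.HasEigenvalue (Matrix.toLin' M) μ} :=
  (Module.End.finite_hasEigenvalue (Matrix.toLin' M)).bddAbove

open Matrix in
/-- The Rayleigh quotients of a symmetric matrix are bounded by its largest eigenvalue. -/
theorem dotProduct_mulVec_le_maxEig_mul {m : ℕ} {M : Matrix (Fin m) (Fin m) ℝ}
    (hM : M.IsHermitian) (x : Fin m → ℝ) :
    x ⬝ᵥ (M *ᵥ x) ≤ maxEig M * (x ⬝ᵥ x) := by
  have hH : (maxEig M • (1 : Matrix (Fin m) (Fin m) ℝ) - M).IsHermitian := by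
    refine IsHermitian.sub ?_ hM
    simp [IsHermitian]
  have hpsd : (maxEig M • (1 : Matrix (Fin m) (Fin m) ℝ) - M).PosSemidef := by
    rw [hH.posSemidef_iff_eigenvalues_nonneg]
    intro i
    have hv := hH.mulVec_eigenvectorBasis i
    have hne : (hH.eigenvectorBasis i : Fin m → ℝ) ≠ 0 := by
      intro h
      refine hH.eigenvectorBasis.toBasis.ne_zero i ?_
      ext l
      simpa using congrFun h l
    have hmem : Module.End.HasEigenvalue (toLin' M) (maxEig M - hH.eigenvalues i) := by
      refine Module.End.hasEigenvalue_of_hasEigenvector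
        (x := (hH.eigenvectorBasis i : Fin m → ℝ)) ⟨?_, hne⟩
      rw [Module.End.mem_eigenspace_iff, toLin'_apply, sub_smul, ← hv, sub_mulVec, smul_mulVec,
        one_mulVec]
      abel
    have := le_csSup (bddAbove_hasEigenvalue M) hmem
    change _ ≤ maxEig M at this
    simp only [Pi.zero_apply]
    linarith
  have h := hpsd.dotProduct_mulVec_nonneg x
  rw [sub_mulVec, smul_mulVec, one_mulVec, dotProduct_sub, dotProduct_smul] at h
  simpa using h

open Matrix in
theorem maxEig_tridiag_zero_le (k : ℕ) (o : ℕ → ℝ) {a : ℝ} (ha : 0 ≤ a)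
    (h0 : ∀ i < k, 0 ≤ o i) (h : ∀ i < k, o i ≤ a) :
    maxEig (Tridiag k (fun _ => 0) o) ≤ 2 * a := by
  refine Real.sSup_le (fun μ hμ => ?_) (by positivity)
  obtain ⟨x, hx, hne⟩ := Module.End.HasEigenvalue.exists_hasEigenvector hμ
  rw [Module.End.mem_eigenspace_iff, toLin'_apply] at hx
  have hq := dotProduct_tridiag_zero_mulVec k o x
  rw [hx, dotProduct_smul, smul_eq_mul] at hq
  have hpos : 0 < x ⬝ᵥ x := by
    have := dotProduct_star_self_pos_iff.2 hne
    simpa using this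
  have hterm : ∀ i : Fin k, 2 * (o i * (x i.castSucc * x i.succ))
      ≤ a * (x i.castSucc * x i.castSucc) + a * (x i.succ * x i.succ) := fun i => by
    nlinarith [mul_nonneg (h0 i i.isLt) (sq_nonneg (x i.castSucc - x i.succ)),
      mul_nonneg (sub_nonneg.2 (h i i.isLt)) (sq_nonneg (x i.castSucc)),
      mul_nonneg (sub_nonneg.2 (h i i.isLt)) (sq_nonneg (x i.succ))]
  have hsum := Finset.sum_le_sum fun i (_ : i ∈ Finset.univ) => hterm i
  rw [← Finset.mul_sum, ← hq, Finset.sum_add_distrib, ← Finset.mul_sum, ← Finset.mul_sum] at hsum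
  have h1 : x ⬝ᵥ x = ∑ i : Fin k, x i.castSucc * x i.castSucc + x (Fin.last k) * x (Fin.last k) :=
    Fin.sum_univ_castSucc _
  have h2 : x ⬝ᵥ x = x 0 * x 0 + ∑ i : Fin k, x i.succ * x i.succ := Fin.sum_univ_succ _
  refine le_of_mul_le_mul_right ?_ hpos
  nlinarith [mul_nonneg ha (mul_self_nonneg (x 0)), mul_nonneg ha (mul_self_nonneg (x (Fin.last k)))]

theorem sum_fin_ite_ge (k t : ℕ) (ht : t ≤ k) :
    ∑ i : Fin k, (if t ≤ (i : ℕ) then (1 : ℝ) else 0) = k - t := by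
  rw [Fin.sum_univ_eq_sum_range (fun i => if t ≤ i then (1 : ℝ) else 0), ← Finset.sum_filter,
    Finset.sum_const, nsmul_one, ← Nat.cast_sub ht]
  congr 1
  have : (Finset.range k).filter (fun i => t ≤ i) = Finset.Ico t k := by
    ext i
    simp [and_comm]
  rw [this, Nat.card_Ico]

open Matrix in
theorem le_maxEig_tridiag_zero (k t : ℕ) (ht : t ≤ k) (o : ℕ → ℝ) {a : ℝ}
    (h : ∀ i, t ≤ i → i < k → a ≤ o i) :
    2 * (((k : ℝ) - t) * a) ≤ maxEig (Tridiag k (fun _ => 0) o) * ((k : ℝ) - t + 1) := by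
  let x : Fin (k + 1) → ℝ := fun i => if t ≤ (i : ℕ) then 1 else 0
  have hq := dotProduct_mulVec_le_maxEig_mul (tridiag_zero_isHermitian k o) x
  have hxx : x ⬝ᵥ x = (k : ℝ) - t + 1 := by
    have := sum_fin_ite_ge (k + 1) t (by omega)
    push_cast at this
    simp only [dotProduct, x, mul_ite, mul_one, mul_zero]
    rw [show (k : ℝ) - t + 1 = k + 1 - t by ring, ← this]
    refine Finset.sum_congr rfl fun i _ => ?_
    split_ifs <;> rfl
  rw [dotProduct_tridiag_zero_mulVec, hxx] at hq
  refine le_trans (mul_le_mul_of_nonneg_left ?_ zero_le_two) hq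
  rw [← sum_fin_ite_ge k t ht, Finset.sum_mul]
  refine Finset.sum_le_sum fun i _ => ?_
  by_cases hi : t ≤ (i : ℕ)
  · have hi' : t ≤ (i : ℕ) + 1 := by omega
    simpa [x, hi, hi'] using h i hi i.isLt
  · simp [x, hi]

/-- The squared recurrence coefficients of the Gegenbauer polynomials increase with the index. -/
theorem gegenbauer_coeff_sq_le {n p q : ℝ} (hn : 5 ≤ n) (hp : 0 ≤ p) (hpq : p ≤ q) :
    (n + p - 2) * (p + 1) / ((n + 2 * p) * (n + 2 * p - 2))
      ≤ (n + q - 2) * (q + 1) / ((n + 2 * q) * (n + 2 * q - 2)) := by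
  have key : ∀ r : ℝ, 0 ≤ r → (n + r - 2) * (r + 1) / ((n + 2 * r) * (n + 2 * r - 2))
      = (1 - ((n - 3) ^ 2 - 1) / ((n + 2 * r) * (n + 2 * r - 2))) / 4 := fun r hr => by
    have h1 : n + 2 * r ≠ 0 := by linarith
    have h2 : n + 2 * r - 2 ≠ 0 := by linarith
    have h3 := mul_ne_zero h1 h2
    rw [div_eq_iff h3, div_mul_eq_mul_div, sub_mul 1, div_mul_cancel₀ _ h3]
    ring
  rw [key p hp, key q (hp.trans hpq)]
  have hden : (n + 2 * p) * (n + 2 * p - 2) ≤ (n + 2 * q) * (n + 2 * q - 2) :=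
    mul_le_mul (by linarith) (by linarith) (by linarith) (by linarith)
  have hpos : 0 < (n + 2 * p) * (n + 2 * p - 2) := mul_pos (by linarith) (by linarith)
  have := div_le_div_of_nonneg_left (show 0 ≤ (n - 3) ^ 2 - 1 by nlinarith) hpos hden
  linarith

theorem gegenbauer_maxEig_le {n : ℕ} (k : ℕ) (hn : 5 ≤ n) :
    maxEig (Tridiag k (fun _ => 0) (fun i : ℕ => Real.sqrt (((n : ℝ) + i - 2) * ((i : ℝ) + 1)
        / (((n : ℝ) + 2 * i) * ((n : ℝ) + 2 * i - 2)))))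
      ≤ 2 * Real.sqrt (((n : ℝ) + k - 3) * (k : ℝ)
          / (((n : ℝ) + 2 * k - 2) * ((n : ℝ) + 2 * k - 4))) := by
  refine maxEig_tridiag_zero_le k _ (Real.sqrt_nonneg _) (fun _ _ => Real.sqrt_nonneg _)
    fun i hi => Real.sqrt_le_sqrt ?_
  have hik : (i : ℝ) ≤ (k : ℝ) - 1 := by
    have : (i : ℝ) + 1 ≤ k := by exact_mod_cast hi
    linarith
  convert gegenbauer_coeff_sq_le (n := (n : ℝ)) (by exact_mod_cast hn) i.cast_nonneg hik using 2
    <;> ring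

theorem le_gegenbauer_maxEig {n k s : ℕ} (hn : 5 ≤ n) (hs : 2 ≤ s) (hsk : s ≤ k) :
    (2 * ((s : ℝ) - 1) / (s : ℝ))
        * Real.sqrt (((n : ℝ) + k - s - 1) * ((k : ℝ) - s + 2)
          / (((n : ℝ) + 2 * k - 2 * s + 2) * ((n : ℝ) + 2 * k - 2 * s)))
      ≤ maxEig (Tridiag k (fun _ => 0) (fun i : ℕ => Real.sqrt (((n : ℝ) + i - 2) * ((i : ℝ) + 1)
          / (((n : ℝ) + 2 * i) * ((n : ℝ) + 2 * i - 2))))) := by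
  have hs0 : (0 : ℝ) < s := by positivity
  have ht : ((k + 1 - s : ℕ) : ℝ) = (k : ℝ) + 1 - s := by
    rw [Nat.cast_sub (by omega)]
    push_cast
    ring
  have h := le_maxEig_tridiag_zero k (k + 1 - s) (by omega)
    (fun i : ℕ => Real.sqrt (((n : ℝ) + i - 2) * ((i : ℝ) + 1)
      / (((n : ℝ) + 2 * i) * ((n : ℝ) + 2 * i - 2))))
    (a := Real.sqrt (((n : ℝ) + k - s - 1) * ((k : ℝ) - s + 2)
          / (((n : ℝ) + 2 * k - 2 * s + 2) * ((n : ℝ) + 2 * k - 2 * s))))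
    (fun i hi _ => by
      refine Real.sqrt_le_sqrt ?_
      have hi' : (k : ℝ) + 1 - s ≤ i := by
        rw [← ht]
        exact_mod_cast hi
      have hp : (0 : ℝ) ≤ (k : ℝ) + 1 - s := by
        rw [← ht]
        positivity
      convert gegenbauer_coeff_sq_le (n := (n : ℝ)) (by exact_mod_cast hn) hp hi' using 2 <;> ring)
  rw [ht] at h
  rw [div_mul_eq_mul_div, div_le_iff₀ hs0]
  calc _ = _ := by ring
    _ ≤ _ := h
    _ = _ := by ring

/-- Limit of the recurrence coefficients, with all offsets scaled by the dimension. -/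
theorem tendsto_sqrt_div_of_tendsto {ρ : ℝ} (hρ : 0 < ρ) {u v w z : ℕ → ℝ}
    (hu : Tendsto u atTop (nhds (1 + ρ))) (hv : Tendsto v atTop (nhds ρ))
    (hw : Tendsto w atTop (nhds (1 + 2 * ρ))) (hz : Tendsto z atTop (nhds (1 + 2 * ρ))) :
    Tendsto (fun j => Real.sqrt (u j * v j / (w j * z j))) atTop
      (nhds (Real.sqrt (ρ * (1 + ρ)) / (1 + 2 * ρ))) := by
  have hpos : 0 < 1 + 2 * ρ := by positivity
  have h := ((hu.mul hv).div (hw.mul hz) (by positivity)).sqrt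
  rwa [Real.sqrt_div (by positivity), Real.sqrt_mul_self hpos.le, mul_comm (1 + ρ)] at h

/-- The common form of the lower and upper bounds, where `m` is negligible against `n`. -/
theorem tendsto_gegenbauer_coeff {ρ : ℝ} (hρ : 0 < ρ) {n k m : ℕ → ℝ} (hn0 : ∀ j, 0 < n j)
    (hn : Tendsto n atTop atTop) (hk : Tendsto (fun j => k j / n j) atTop (nhds ρ))
    (hm : Tendsto (fun j => m j / n j) atTop (nhds 0)) (a b c d : ℝ) :
    Tendsto (fun j => Real.sqrt ((n j + k j - m j + a) * (k j - m j + b)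
        / ((n j + 2 * k j - 2 * m j + c) * (n j + 2 * k j - 2 * m j + d)))) atTop
      (nhds (Real.sqrt (ρ * (1 + ρ)) / (1 + 2 * ρ))) := by
  have hc : ∀ c : ℝ, Tendsto (fun j => c / n j) atTop (nhds 0) := fun c => hn.const_div_atTop c
  have hu : Tendsto (fun j => 1 + k j / n j - m j / n j + a / n j) atTop (nhds (1 + ρ)) := by
    simpa using ((tendsto_const_nhds (x := (1 : ℝ))).add hk |>.sub hm).add (hc a)
  have hv : Tendsto (fun j => k j / n j - m j / n j + b / n j) atTop (nhds ρ) := by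
    simpa using (hk.sub hm).add (hc b)
  have hw : ∀ c : ℝ, Tendsto (fun j => 1 + 2 * (k j / n j) - 2 * (m j / n j) + c / n j) atTop
      (nhds (1 + 2 * ρ)) := fun c => by
    simpa using (((tendsto_const_nhds (x := (1 : ℝ))).add (hk.const_mul 2)).sub
      (hm.const_mul 2)).add (hc c)
  refine (tendsto_sqrt_div_of_tendsto hρ hu hv (hw c) (hw d)).congr fun j => ?_
  have := (hn0 j).ne'
  have e1 : n j + k j - m j + a = n j * (1 + k j / n j - m j / n j + a / n j) := by field_simp
  have e2 : k j - m j + b = n j * (k j / n j - m j / n j + b / n j) := by field_simp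
  have e3 : ∀ c, n j + 2 * k j - 2 * m j + c
      = n j * (1 + 2 * (k j / n j) - 2 * (m j / n j) + c / n j) := fun c => by field_simp
  rw [e1, e2, e3 c, e3 d, mul_mul_mul_comm, mul_mul_mul_comm (n j) _ (n j),
    mul_div_mul_left _ _ (mul_ne_zero this this)]

theorem tendsto_natSqrt_atTop : Tendsto Nat.sqrt atTop atTop :=
  tendsto_atTop_atTop.2 fun b => ⟨b * b, fun _ h => Nat.le_sqrt.2 h⟩

theorem tendsto_gegenbauer_maxEig {ρ : ℝ} (hρ : 0 < ρ) {n k : ℕ → ℕ} (hn0 : ∀ j, 0 < n j)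
    (hn : Tendsto n atTop atTop)
    (hk : Tendsto (fun j => (k j : ℝ) / (n j : ℝ)) atTop (nhds ρ)) :
    Tendsto (fun j => maxEig (Tridiag (k j) (fun _ => 0)
        (fun i : ℕ => Real.sqrt (((n j : ℝ) + i - 2) * ((i : ℝ) + 1)
          / (((n j : ℝ) + 2 * i) * ((n j : ℝ) + 2 * i - 2))))))
      atTop (nhds (2 * Real.sqrt (ρ * (1 + ρ)) / (1 + 2 * ρ))) := by
  have hn0' : ∀ j, (0 : ℝ) < n j := fun j => by exact_mod_cast hn0 j
  have hnR : Tendsto (fun j => (n j : ℝ)) atTop atTop := tendsto_natCast_atTop_atTop.comp hn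
  have hkR : Tendsto (fun j => (k j : ℝ)) atTop atTop :=
    (hk.pos_mul_atTop hρ hnR).congr fun j => div_mul_cancel₀ _ (hn0' j).ne'
  have hkN : Tendsto k atTop atTop := tendsto_natCast_atTop_iff.1 hkR
  have hsN : Tendsto (fun j => Nat.sqrt (k j)) atTop atTop := tendsto_natSqrt_atTop.comp hkN
  have hsR : Tendsto (fun j => ((Nat.sqrt (k j) : ℕ) : ℝ)) atTop atTop :=
    tendsto_natCast_atTop_atTop.comp hsN
  have hm : Tendsto (fun j => ((Nat.sqrt (k j) : ℕ) : ℝ) / (n j : ℝ)) atTop (nhds 0) := by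
    have hbound : Tendsto (fun j => (k j : ℝ) / (n j : ℝ) / (Nat.sqrt (k j) : ℕ)) atTop (nhds 0) :=
      hk.div_atTop hsR
    refine squeeze_zero' (Eventually.of_forall fun j => by positivity) ?_ hbound
    filter_upwards [hsN.eventually_ge_atTop 1] with j hj
    have hs0 : (0 : ℝ) < (Nat.sqrt (k j) : ℕ) := by exact_mod_cast hj
    rw [le_div_iff₀ hs0, div_mul_eq_mul_div]
    gcongr
    exact_mod_cast Nat.sqrt_le (k j)
  have hfac : Tendsto (fun j => 2 * (((Nat.sqrt (k j) : ℕ) : ℝ) - 1) / ((Nat.sqrt (k j) : ℕ) : ℝ))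
      atTop (nhds 2) := by
    have h : Tendsto (fun j => 2 - 2 / ((Nat.sqrt (k j) : ℕ) : ℝ)) atTop (nhds (2 - 0)) :=
      tendsto_const_nhds.sub (hsR.const_div_atTop 2)
    rw [sub_zero] at h
    refine h.congr' ?_
    filter_upwards [hsN.eventually_ge_atTop 1] with j hj
    have hs0 : ((Nat.sqrt (k j) : ℕ) : ℝ) ≠ 0 := by
      have : Nat.sqrt (k j) ≠ 0 := by omega
      exact_mod_cast this
    field_simp
  have hlow := hfac.mul (tendsto_gegenbauer_coeff hρ hn0' hnR hk hm (-1) 2 2 0)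
  have hupp := (tendsto_gegenbauer_coeff hρ hn0' hnR hk
    (m := fun _ => 0) (by simp) (-3) 0 (-2) (-4)).const_mul 2
  rw [← mul_div_assoc] at hlow hupp
  refine tendsto_of_tendsto_of_tendsto_of_le_of_le' hlow hupp ?_ ?_
  · filter_upwards [hn.eventually_ge_atTop 5, hsN.eventually_ge_atTop 2] with j hj hs
    refine (le_of_eq ?_).trans (le_gegenbauer_maxEig hj hs (Nat.sqrt_le_self (k j)))
    ring_nf
  · filter_upwards [hn.eventually_ge_atTop 5] with j hj
    refine (gegenbauer_maxEig_le (k j) hj).trans (le_of_eq ?_)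
    ring_nf

/-- Lemma 6: bounds and asymptotics for the largest eigenvalue of the Gegenbauer
tridiagonal matrix `S_k`. -/
theorem gegenbauer_maxEig_bounds_and_limit (n k : ℕ) (hn : 5 ≤ n) (hk : 2 ≤ k) :
    (∀ s : ℕ, 2 ≤ s → s ≤ k →
      (2 * ((s : ℝ) - 1) / (s : ℝ))
          * Real.sqrt (((n : ℝ) + k - s - 1) * ((k : ℝ) - s + 2)
            / (((n : ℝ) + 2 * k - 2 * s + 2) * ((n : ℝ) + 2 * k - 2 * s)))
        ≤ maxEig (Tridiag k (fun _ => 0) (fun i : ℕ => Real.sqrt (((n : ℝ) + i - 2) * ((i : ℝ) + 1)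
            / (((n : ℝ) + 2 * i) * ((n : ℝ) + 2 * i - 2)))))
      ∧ maxEig (Tridiag k (fun _ => 0) (fun i : ℕ => Real.sqrt (((n : ℝ) + i - 2) * ((i : ℝ) + 1)
            / (((n : ℝ) + 2 * i) * ((n : ℝ) + 2 * i - 2)))))
        ≤ 2 * Real.sqrt (((n : ℝ) + k - 3) * (k : ℝ)
            / (((n : ℝ) + 2 * k - 2) * ((n : ℝ) + 2 * k - 4))))
    ∧ ∀ (ρ : ℝ), 0 < ρ → ∀ nj kj : ℕ → ℕ, (∀ j, 0 < nj j) → (∀ j, 0 < kj j) →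
        Tendsto nj atTop atTop →
        Tendsto (fun j => (kj j : ℝ) / (nj j : ℝ)) atTop (nhds ρ) →
        Tendsto (fun j => maxEig (Tridiag (kj j) (fun _ => 0)
            (fun i : ℕ => Real.sqrt (((nj j : ℝ) + i - 2) * ((i : ℝ) + 1)
              / (((nj j : ℝ) + 2 * i) * ((nj j : ℝ) + 2 * i - 2))))))
          atTop (nhds (2 * Real.sqrt (ρ * (1 + ρ)) / (1 + 2 * ρ))) := by
  exact ⟨fun s hs hsk => ⟨le_gegenbauer_maxEig hn hs hsk, gegenbauer_maxEig_le k hn⟩,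
    fun ρ hρ nj kj hnj _ hn_top hratio => tendsto_gegenbauer_maxEig hρ hnj hn_top hratio⟩
end
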